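/- arXiv:1305.7495 — 2 statements merged into one kernel-verified Lean document; each statement's English description precedes it below -/
import Mathlib

section
/- Let A be any C*-algebra. If C([0,1],A) has stable rank one, then A has no K₁-obstructions; that is, A has stable rank one and K₁(B) = 0 for every hereditary subalgebra B of A. -/
noncomputable section

set_option maxHeartbeats 1000000

def StableRankOne (A : Type*) [NonUnitalCStarAlgebra A] : Prop :=
  Dense {x : Unitization ℂ A | IsUnit x}

def K1Trivial (B : Type*) [NonUnitalCStarAlgebra B] : Prop :=
  ∀ n : ℕ, 0 < n → ∀ u : unitary (Matrix (Fin n) (Fin n) (Unitization ℂ B)),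
    ∃ (k : ℕ) (h : Matrix.fromBlocks u.1 0 0
        (1 : Matrix (Fin k) (Fin k) (Unitization ℂ B)) ∈
        unitary (Matrix (Fin n ⊕ Fin k) (Fin n ⊕ Fin k) (Unitization ℂ B))),
      Joined (1 : unitary (Matrix (Fin n ⊕ Fin k) (Fin n ⊕ Fin k) (Unitization ℂ B)))
        ⟨Matrix.fromBlocks u.1 0 0 1, h⟩

def NoK1Obstructions (A : Type*) [NonUnitalCStarAlgebra A] : Prop :=
  StableRankOne A ∧
    ∀ (B : NonUnitalStarSubalgebra ℂ A) [IsClosed (B : Set A)],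
      (∀ b ∈ B, ∀ a : A, ∀ b' ∈ B, b * a * b' ∈ B) → K1Trivial B


open Topology

/-- Every segment from `1` to `1 + b` in the unitization of `B` can be uniformly approximated by a
path of invertible elements. -/
def SegmentApprox (B : Type*) [NonUnitalCStarAlgebra B] : Prop :=
  ∀ b : B, ∀ ε > 0, ∃ p : C(unitInterval, B),
    (∀ t, IsUnit (1 + (p t : Unitization ℂ B))) ∧ ∀ t : unitInterval, ‖p t - (t : ℝ) • b‖ < ε

theorem exists_approx_unit {B : Type*} [NonUnitalCStarAlgebra B] (b : B) {δ : ℝ} (hδ : 0 < δ) :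
    ∃ e : B, ‖e‖ ≤ 1 ∧ ‖b * e - b‖ < δ ∧ ‖e * b - b‖ < δ := by
  let _ := CStarAlgebra.spectralOrder B
  let _ := CStarAlgebra.spectralOrderedRing B
  have h := CStarAlgebra.increasingApproximateUnit B
  have := h.neBot
  have h1 := (h.tendsto_mul_left b).eventually (Metric.ball_mem_nhds b hδ)
  have h2 := (h.tendsto_mul_right b).eventually (Metric.ball_mem_nhds b hδ)
  obtain ⟨e, he, h1, h2⟩ := (h.eventually_norm.and (h1.and h2)).exists
  rw [dist_eq_norm] at h1 h2
  exact ⟨e, he, h1, h2⟩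

theorem exists_inverse_near {R : Type*} [NormedRing R] [CompleteSpace R] {ε : ℝ} (hε : 0 < ε) :
    ∃ δ > 0, ∀ a : R, ‖a‖ < δ → ∃ c : R, IsUnit c ∧ c * (1 + a) = 1 ∧ ‖c - 1‖ < ε := by
  have h1 : ∀ᶠ x in 𝓝 (1 : R), IsUnit x := Units.isOpen.mem_nhds isUnit_one
  have h2 : ∀ᶠ x in 𝓝 (1 : R), ‖Ring.inverse x - 1‖ < ε := by
    have := (NormedRing.inverse_continuousAt (1 : Rˣ)).eventually
      (Metric.ball_mem_nhds _ hε)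
    simpa [dist_eq_norm] using this
  obtain ⟨δ, hδ, h⟩ := Metric.eventually_nhds_iff.mp (h1.and h2)
  refine ⟨δ, hδ, fun a ha => ?_⟩
  obtain ⟨hu, hn⟩ := h (y := 1 + a) (by simpa [dist_eq_norm] using ha)
  exact ⟨_, hu.ringInverse, Ring.inverse_mul_cancel _ hu, hn⟩

theorem exists_inverse_near_mul {R : Type*} [NormedRing R] [CompleteSpace R]
    (β : R) {ε : ℝ} (hε : 0 < ε) :
    ∃ δ > 0, ∀ η Y : R, ‖η‖ ≤ 1 → ‖β * η - β‖ < δ → ‖η * β - β‖ < δ → IsUnit Y →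
      ‖Y - (1 + β)‖ < δ → ∃ w z : R, (1 + η * w * β) * (1 + η * z * β) = 1 ∧
        (1 + η * z * β) * (1 + η * w * β) = 1 ∧ ‖η * w * β - β‖ < ε := by
  obtain ⟨δ, hδ, H⟩ := exists_inverse_near (R := R) (ε := ε / 2 / (‖β‖ + 1)) (by positivity)
  refine ⟨min (δ / 2) (ε / 2), by positivity, fun η Y hη h1 h2 hY h3 => ?_⟩
  obtain ⟨c, hc, hc1, hc2⟩ := H (Y - 1 - β * η) (by
    calc ‖Y - 1 - β * η‖ = ‖(Y - (1 + β)) - (β * η - β)‖ := by congr 1; abel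
      _ ≤ ‖Y - (1 + β)‖ + ‖β * η - β‖ := norm_sub_le _ _
      _ < δ := by
        have := min_le_left (δ / 2) (ε / 2)
        linarith)
  have hcY : c * Y = 1 + c * β * η := by
    have : c * Y = c * (1 + (Y - 1 - β * η)) + c * β * η := by noncomm_ring
    rw [this, hc1]
  obtain ⟨v, hv⟩ := hc.mul hY
  rw [hcY] at hv
  have e1 : (1 + c * β * η) * (↑v⁻¹ : R) = 1 := by rw [← hv]; simp
  have e2 : (↑v⁻¹ : R) * (1 + c * β * η) = 1 := by rw [← hv]; simp
  set s : R := ↑v⁻¹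
  refine ⟨c, -(s * c), ?_, ?_, ?_⟩
  · calc _ = 1 + η * c * β - η * ((1 + c * β * η) * s) * c * β := by noncomm_ring
      _ = 1 := by rw [e1]; noncomm_ring
  · calc _ = 1 + η * c * β - η * (s * (1 + c * β * η)) * c * β := by noncomm_ring
      _ = 1 := by rw [e2]; noncomm_ring
  · have hb : ‖c - 1‖ * (‖β‖ + 1) < ε / 2 := by rwa [← lt_div_iff₀ (by positivity)]
    calc ‖η * c * β - β‖ = ‖η * ((c - 1) * β) + (η * β - β)‖ := by congr 1; noncomm_ring
      _ ≤ ‖η * ((c - 1) * β)‖ + ‖η * β - β‖ := norm_add_le _ _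
      _ ≤ ‖η‖ * (‖c - 1‖ * ‖β‖) + ‖η * β - β‖ := by
        gcongr; exact (norm_mul_le _ _).trans (by gcongr; exact norm_mul_le _ _)
      _ ≤ 1 * (‖c - 1‖ * (‖β‖ + 1)) + ‖η * β - β‖ := by gcongr; linarith
      _ < ε := by
        have := min_le_right (δ / 2) (ε / 2)
        linarith

theorem segmentApprox_of_hereditary {A B : Type*} [NonUnitalCStarAlgebra A]
    [NonUnitalCStarAlgebra B] (h : StableRankOne C(unitInterval, A)) (φ : B →⋆ₙₐ[ℂ] A)
    (hφ : Isometry φ) (her : ∀ (b b' : B) (a : A), ∃ d, φ d = φ b * a * φ b') :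
    SegmentApprox B := by
  intro b ε hε
  let cb : C(unitInterval, A) := ⟨fun t => (t : ℝ) • φ b, by fun_prop⟩
  obtain ⟨δ, hδ, H⟩ := exists_inverse_near_mul (cb : Unitization ℂ C(unitInterval, A)) hε
  obtain ⟨e, he, hbe, heb⟩ := exists_approx_unit b hδ
  have hnorm : ∀ x : B, ‖φ x‖ = ‖x‖ := fun x => hφ.norm_map_of_map_zero (map_zero φ) x
  have hsm : ∀ (t : unitInterval) (x : B), ‖x‖ < δ → ‖(t : ℝ) • φ x‖ < δ := fun t x hx => by
    rw [norm_smul, hnorm, Real.norm_of_nonneg t.2.1]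
    nlinarith [t.2.1, t.2.2, norm_nonneg x]
  let ce : C(unitInterval, A) := ContinuousMap.const _ (φ e)
  obtain ⟨Y, hY, hYn⟩ := Metric.dense_iff.mp h (1 + (cb : Unitization ℂ C(unitInterval, A))) δ hδ
  rw [Metric.mem_ball, dist_eq_norm] at hY
  have hcbe : ‖cb * ce - cb‖ < δ := by
    rw [ContinuousMap.norm_lt_iff _ hδ]
    intro t
    have : (cb * ce - cb) t = (t : ℝ) • φ (b * e - b) := by
      simp [cb, ce, smul_sub, smul_mul_assoc]
    rw [this]; exact hsm t _ hbe
  have hceb : ‖ce * cb - cb‖ < δ := by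
    rw [ContinuousMap.norm_lt_iff _ hδ]
    intro t
    have : (ce * cb - cb) t = (t : ℝ) • φ (e * b - b) := by
      simp [cb, ce, smul_sub, mul_smul_comm]
    rw [this]; exact hsm t _ heb
  obtain ⟨w, z, hwz, hzw, hw⟩ := H (ce : Unitization ℂ C(unitInterval, A)) Y
    (by
      rw [Unitization.norm_inr, ContinuousMap.norm_le _ zero_le_one]
      intro t; simpa [ce, hnorm] using he)
    (by rw [← Unitization.inr_mul, ← Unitization.inr_sub, Unitization.norm_inr]; exact hcbe)
    (by rw [← Unitization.inr_mul, ← Unitization.inr_sub, Unitization.norm_inr]; exact hceb)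
    hYn hY
  have key : ∀ w : Unitization ℂ C(unitInterval, A), ∃ p : C(unitInterval, B),
      ∃ f : C(unitInterval, A), (∀ t, f t = φ (p t)) ∧
      (ce : Unitization ℂ C(unitInterval, A)) * w * cb =
        (f : Unitization ℂ C(unitInterval, A)) := by
    intro w
    let f : C(unitInterval, A) := w.fst • (ce * cb) + ce * w.snd * cb
    have hf : ∀ t, ∃ d, φ d = f t := by
      intro t
      obtain ⟨d, hd⟩ := her e ((t : ℝ) • b) (w.snd t)
      refine ⟨w.fst • (e * ((t : ℝ) • b)) + d, ?_⟩
      have hr : φ ((t : ℝ) • b) = (t : ℝ) • φ b := map_real_smul φ hφ.continuous _ _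
      simp only [map_add, map_smul, map_mul, hd, hr]
      simp [f, ce, cb]
    choose p hp using hf
    refine ⟨⟨p, hφ.isEmbedding.isInducing.continuous_iff.mpr ?_⟩, f, fun t => (hp t).symm, ?_⟩
    · exact f.continuous.congr fun t => (hp t).symm
    · induction w using Unitization.ind with
      | inl_add_inr l a =>
        ext <;> simp [f, mul_add, add_mul, smul_mul_assoc]
  obtain ⟨p, f, hf, hp⟩ := key w
  obtain ⟨q, g, hg, hq⟩ := key z
  rw [hp, hq] at hwz hzw
  rw [hp, ← Unitization.inr_sub, Unitization.norm_inr, ContinuousMap.norm_lt_iff _ hε] at hw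
  have quasi : ∀ {f g : C(unitInterval, A)} {p q : C(unitInterval, B)}, (∀ t, f t = φ (p t)) →
      (∀ t, g t = φ (q t)) →
      (1 + (f : Unitization ℂ C(unitInterval, A))) *
        (1 + (g : Unitization ℂ C(unitInterval, A))) = 1 →
      ∀ t, (1 + (p t : Unitization ℂ B)) * (1 + (q t : Unitization ℂ B)) = 1 := by
    intro f g p q hf hg h t
    have h1 := congrArg (fun x => x.snd t) h
    have h2 : p t + q t + p t * q t = 0 := hφ.injective (by
      simpa [hf, hg, mul_add, add_mul, add_assoc, add_comm, add_left_comm] using h1)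
    have h3 : (1 + (p t : Unitization ℂ B)) * (1 + (q t : Unitization ℂ B)) =
      1 + ((p t + q t + p t * q t : B) : Unitization ℂ B) := by
      simp only [Unitization.inr_add, Unitization.inr_mul]; noncomm_ring
    rw [h3, h2]; simp
  refine ⟨p, fun t => ⟨⟨_, _, quasi hf hg hwz t, quasi hg hf hzw t⟩, rfl⟩, fun t => ?_⟩
  rw [← hnorm, map_sub, map_real_smul φ hφ.continuous, ← hf]
  exact hw t

theorem JoinedIn.isUnit_mul {M : Type*} [Monoid M] [TopologicalSpace M] [ContinuousMul M]
    {a b c d : M} (hab : JoinedIn {z : M | IsUnit z} a b) (hcd : JoinedIn {z : M | IsUnit z} c d) :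
    JoinedIn {z : M | IsUnit z} (a * c) (b * d) :=
  (hab.mul hcd).mono (by
    rintro _ ⟨x, hx, y, hy, rfl⟩
    exact IsUnit.mul hx hy)

theorem JoinedIn.isUnit_map {M N : Type*} [Monoid M] [TopologicalSpace M] [Monoid N]
    [TopologicalSpace N] {a b : M} (h : JoinedIn {z : M | IsUnit z} a b) (f : M →* N)
    (hf : Continuous f) : JoinedIn {z : N | IsUnit z} (f a) (f b) :=
  (h.map hf).mono (by
    rintro _ ⟨x, hx, rfl⟩
    exact IsUnit.map f hx)

theorem isUnit_smul_of_ne_zero {R : Type*} [Ring R] [Algebra ℂ R] {l : ℂ} (hl : l ≠ 0) {x : R}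
    (hx : IsUnit x) : IsUnit (l • x) := by
  rw [Algebra.smul_def]
  exact ((IsUnit.mk0 l hl).map (algebraMap ℂ R)).mul hx

theorem SegmentApprox.stableRankOne {B : Type*} [NonUnitalCStarAlgebra B] (h : SegmentApprox B) :
    StableRankOne B := by
  have hd : Dense {x : Unitization ℂ B | x.fst ≠ 0} :=
    (dense_compl_singleton (0 : ℂ)).preimage
      (isOpenMap_fst.comp Unitization.uniformEquivProd.toHomeomorph.isOpenMap)
  refine dense_closure.mp (hd.mono fun x hx => ?_)
  rw [Metric.mem_closure_iff]
  intro ε hε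
  have hl : 0 < ‖x.fst‖ := norm_pos_iff.mpr hx
  obtain ⟨p, hp, hpn⟩ := h (x.fst⁻¹ • x.snd) (ε / ‖x.fst‖) (by positivity)
  refine ⟨x.fst • (1 + (p 1 : Unitization ℂ B)), isUnit_smul_of_ne_zero hx (hp 1), ?_⟩
  have hx1 : x = x.fst • (1 + ((x.fst⁻¹ • x.snd : B) : Unitization ℂ B)) := by
    ext <;> simp [smul_smul, mul_inv_cancel₀ hx]
  have h1 := hpn 1
  rw [lt_div_iff₀' hl] at h1
  calc dist x _ = dist (x.fst • (1 + ((x.fst⁻¹ • x.snd : B) : Unitization ℂ B)))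
        (x.fst • (1 + (p 1 : Unitization ℂ B))) := by rw [← hx1]
    _ = ‖x.fst‖ * ‖p 1 - x.fst⁻¹ • x.snd‖ := by
      rw [dist_comm, dist_eq_norm, ← smul_sub, norm_smul, add_sub_add_left_eq_sub,
        ← Unitization.inr_sub, Unitization.norm_inr]
    _ < ε := by simpa using h1

theorem exists_joinedIn_isUnit {R : Type*} [NormedRing R] [NormedAlgebra ℝ R] [CompleteSpace R]
    {x : R} (hx : IsUnit x) :
    ∃ δ > 0, ∀ y, ‖y - x‖ < δ → JoinedIn {z : R | IsUnit z} x y := by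
  obtain ⟨δ, hδ, h⟩ := Metric.isOpen_iff.mp (Units.isOpen (R := R)) x hx
  refine ⟨δ, hδ, fun y hy => ?_⟩
  exact (((convex_ball x δ).isPathConnected ⟨x, Metric.mem_ball_self hδ⟩).joinedIn _
    (Metric.mem_ball_self hδ) _ (by simpa [dist_eq_norm] using hy)).mono h

theorem SegmentApprox.joinedIn_isUnit {B : Type*} [NonUnitalCStarAlgebra B] (h : SegmentApprox B)
    {x : Unitization ℂ B} (hx : IsUnit x) :
    JoinedIn {z : Unitization ℂ B | IsUnit z} x 1 := by
  have hl : x.fst ≠ 0 := (hx.map (Unitization.fstHom ℂ B)).ne_zero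
  set b : B := x.fst⁻¹ • x.snd
  have hx1 : x = x.fst • (1 + (b : Unitization ℂ B)) := by
    ext <;> simp [b, smul_smul, mul_inv_cancel₀ hl]
  have hx2 : 1 + (b : Unitization ℂ B) = x.fst⁻¹ • x := by
    ext <;> simp [b, hl]
  have hb : IsUnit (1 + (b : Unitization ℂ B)) := by
    rw [hx2]; exact isUnit_smul_of_ne_zero (inv_ne_zero hl) hx
  have hb1 : JoinedIn {z : Unitization ℂ B | IsUnit z} (1 + (b : Unitization ℂ B)) 1 := by
    obtain ⟨δ₁, hδ₁, h₁⟩ := exists_joinedIn_isUnit hb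
    obtain ⟨δ₀, hδ₀, h₀⟩ := exists_joinedIn_isUnit (isUnit_one (M := Unitization ℂ B))
    obtain ⟨p, hp, hpn⟩ := h b (min δ₁ δ₀) (by positivity)
    have c0 := hpn 0
    have c1 := hpn 1
    simp only [Set.Icc.coe_zero, Set.Icc.coe_one, zero_smul, one_smul, sub_zero] at c0 c1
    refine (h₁ (1 + (p 1 : Unitization ℂ B)) ?_).trans (JoinedIn.symm ?_)
    · rw [add_sub_add_left_eq_sub, ← Unitization.inr_sub, Unitization.norm_inr]
      exact c1.trans_le (min_le_left _ _)
    · refine (h₀ (1 + (p 0 : Unitization ℂ B)) ?_).trans ?_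
      · rw [add_sub_cancel_left, Unitization.norm_inr]
        exact c0.trans_le (min_le_right _ _)
      · exact ⟨⟨⟨fun t => 1 + (p t : Unitization ℂ B),
          continuous_const.add ((Unitization.isometry_inr (𝕜 := ℂ)).continuous.comp p.continuous)⟩,
          rfl, rfl⟩, hp⟩
  have hl1 : JoinedIn ({0}ᶜ : Set ℂ) x.fst 1 :=
    (isPathConnected_compl_singleton_of_one_lt_rank (by simp) 0).joinedIn _ hl _ one_ne_zero
  have hl2 : JoinedIn {z : Unitization ℂ B | IsUnit z} (algebraMap ℂ (Unitization ℂ B) x.fst)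
      (algebraMap ℂ (Unitization ℂ B) 1) :=
    (hl1.map (continuous_algebraMap ℂ (Unitization ℂ B))).mono (by
      rintro _ ⟨l, hl, rfl⟩
      exact (IsUnit.mk0 l hl).map (algebraMap ℂ (Unitization ℂ B)))
  have hl3 := hl2.isUnit_mul hb1
  rw [← Algebra.smul_def, ← hx1, map_one, mul_one] at hl3
  exact hl3

namespace Matrix

section

variable {R m n : Type*} [Ring R] [Fintype m] [DecidableEq m] [Fintype n] [DecidableEq n]

theorem fromBlocks_one_lower_mul_neg (C : Matrix n m R) :
    fromBlocks 1 0 C 1 * fromBlocks 1 0 (-C) 1 = (1 : Matrix (m ⊕ n) (m ⊕ n) R) := by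
  simp [fromBlocks_multiply]

theorem fromBlocks_one_upper_mul_neg (B : Matrix m n R) :
    fromBlocks 1 B 0 1 * fromBlocks 1 (-B) 0 1 = (1 : Matrix (m ⊕ n) (m ⊕ n) R) := by
  simp [fromBlocks_multiply]

theorem isUnit_fromBlocks_one_lower (C : Matrix n m R) :
    IsUnit (fromBlocks 1 0 C 1 : Matrix (m ⊕ n) (m ⊕ n) R) :=
  isUnit_iff_exists.mpr ⟨_, fromBlocks_one_lower_mul_neg C,
    by simpa only [neg_neg] using fromBlocks_one_lower_mul_neg (-C)⟩

theorem isUnit_fromBlocks_one_upper (B : Matrix m n R) :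
    IsUnit (fromBlocks 1 B 0 1 : Matrix (m ⊕ n) (m ⊕ n) R) :=
  isUnit_iff_exists.mpr ⟨_, fromBlocks_one_upper_mul_neg B,
    by simpa only [neg_neg] using fromBlocks_one_upper_mul_neg (-B)⟩

/-- The block diagonal embedding of a product of matrix rings. -/
def blockDiag₂ : Matrix m m R × Matrix n n R →* Matrix (m ⊕ n) (m ⊕ n) R where
  toFun x := fromBlocks x.1 0 0 x.2
  map_one' := by simp
  map_mul' x y := by simp [fromBlocks_multiply]

theorem isUnit_of_fromBlocks_diag {P : Matrix m m R} {Q : Matrix n n R}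
    (h : IsUnit (fromBlocks P 0 0 Q)) : IsUnit Q := by
  obtain ⟨⟨_, Y, h1, h2⟩, rfl⟩ := h
  rw [← fromBlocks_toBlocks Y, fromBlocks_multiply, ← fromBlocks_one, fromBlocks_inj] at h1 h2
  exact ⟨⟨Q, Y.toBlocks₂₂, by simpa using h1.2.2.2, by simpa using h2.2.2.2⟩, rfl⟩

end

section

variable {R m n : Type*} [NormedRing R]
  [Fintype m] [DecidableEq m] [Fintype n] [DecidableEq n]

theorem joinedIn_isUnit_fromBlocks_diag
    (hm : ∀ X : Matrix m m R, IsUnit X → JoinedIn {Z : Matrix m m R | IsUnit Z} X 1)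
    (hn : ∀ X : Matrix n n R, IsUnit X → JoinedIn {Z : Matrix n n R | IsUnit Z} X 1)
    {P : Matrix m m R} {Q : Matrix n n R} (hP : IsUnit P) (hQ : IsUnit Q) :
    JoinedIn {Z : Matrix (m ⊕ n) (m ⊕ n) R | IsUnit Z} (fromBlocks P 0 0 Q) 1 := by
  have h := (((hm P hP).prod (hn Q hQ)).mono (V := {Z | IsUnit Z})
    (fun Z hZ => Prod.isUnit_iff.mpr hZ)).isUnit_map (blockDiag₂ (R := R) (m := m) (n := n))
    (continuous_fst.matrix_fromBlocks continuous_const continuous_const continuous_snd)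
  simpa [blockDiag₂] using h

theorem isOpen_isUnit [CompleteSpace R] : IsOpen {X : Matrix m m R | IsUnit X} := by
  let N : NormedRing (Matrix m m R) := Matrix.linftyOpNormedRing
  have : @CompleteSpace (Matrix m m R) N.toMetricSpace.toUniformSpace :=
    (inferInstance : CompleteSpace (m → m → R))
  exact Units.isOpen

theorem joinedIn_isUnit_unit
    (h1 : ∀ x : R, IsUnit x → JoinedIn {z : R | IsUnit z} x 1)
    (X : Matrix Unit Unit R) (hX : IsUnit X) :
    JoinedIn {Z : Matrix Unit Unit R | IsUnit Z} X 1 := by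
  have h := (h1 _ (hX.map (uniqueRingEquiv : Matrix Unit Unit R ≃+* R))).isUnit_map
    ((uniqueRingEquiv : Matrix Unit Unit R ≃+* R).symm : R →* Matrix Unit Unit R) (by
      exact continuous_pi fun _ => continuous_pi fun _ => continuous_id)
  simpa only [MonoidHom.coe_coe, RingEquiv.symm_apply_apply, map_one] using h

variable [NormedAlgebra ℝ R]

theorem joinedIn_isUnit_fromBlocks_one_lower (C : Matrix n m R) :
    JoinedIn {Z : Matrix (m ⊕ n) (m ⊕ n) R | IsUnit Z} (fromBlocks 1 0 C 1) 1 :=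
  JoinedIn.symm ⟨⟨⟨fun t => fromBlocks 1 0 ((t : ℝ) • C) 1,
    continuous_const.matrix_fromBlocks continuous_const (by fun_prop) continuous_const⟩,
    by simp, by simp⟩, fun _ => isUnit_fromBlocks_one_lower _⟩

theorem joinedIn_isUnit_fromBlocks_one_upper (B : Matrix m n R) :
    JoinedIn {Z : Matrix (m ⊕ n) (m ⊕ n) R | IsUnit Z} (fromBlocks 1 B 0 1) 1 :=
  JoinedIn.symm ⟨⟨⟨fun t => fromBlocks 1 ((t : ℝ) • B) 0 1,
    continuous_const.matrix_fromBlocks (by fun_prop) continuous_const continuous_const⟩,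
    by simp, by simp⟩, fun _ => isUnit_fromBlocks_one_upper _⟩

theorem joinedIn_isUnit_fromBlocks
    (hm : ∀ X : Matrix m m R, IsUnit X → JoinedIn {Z : Matrix m m R | IsUnit Z} X 1)
    (hn : ∀ X : Matrix n n R, IsUnit X → JoinedIn {Z : Matrix n n R | IsUnit Z} X 1)
    {P : Matrix m m R} {B : Matrix m n R} {C : Matrix n m R} {D : Matrix n n R}
    (hX : IsUnit (fromBlocks P B C D)) (hP : IsUnit P) :
    JoinedIn {Z : Matrix (m ⊕ n) (m ⊕ n) R | IsUnit Z} (fromBlocks P B C D) 1 := by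
  obtain ⟨P', h1, h2⟩ := isUnit_iff_exists.mp hP
  have hLDU : fromBlocks P B C D = fromBlocks 1 0 (C * P') 1 *
      fromBlocks P 0 0 (D - C * P' * B) * fromBlocks 1 (P' * B) 0 1 := by
    simp [fromBlocks_multiply, ← Matrix.mul_assoc, h1, Matrix.mul_assoc _ P' P, h2]
  have hQ : IsUnit (D - C * P' * B) := by
    rw [hLDU] at hX
    apply isUnit_of_fromBlocks_diag (P := P)
    rw [(isUnit_fromBlocks_one_upper _).mul_right_iff,
      (isUnit_fromBlocks_one_lower _).mul_left_iff] at hX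
    exact hX
  have := ((joinedIn_isUnit_fromBlocks_one_lower (C * P')).isUnit_mul
    (joinedIn_isUnit_fromBlocks_diag hm hn hP hQ)).isUnit_mul
    (joinedIn_isUnit_fromBlocks_one_upper (P' * B))
  rw [hLDU]
  simpa using this

theorem exists_joinedIn_isUnit_fromBlocks [CompleteSpace R]
    (hd : Dense {x : R | IsUnit x})
    {a : R} {B : Matrix Unit n R} {C : Matrix n Unit R} {D : Matrix n n R}
    (hX : IsUnit (fromBlocks (of fun _ _ => a) B C D)) :
    ∃ a' : R, IsUnit a' ∧ JoinedIn {Z : Matrix (Unit ⊕ n) (Unit ⊕ n) R | IsUnit Z}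
      (fromBlocks (of fun _ _ => a) B C D) (fromBlocks (of fun _ _ => a') B C D) := by
  let f : R → Matrix (Unit ⊕ n) (Unit ⊕ n) R := fun x => fromBlocks (of fun _ _ => x) B C D
  have h1 : Continuous fun x : R => (of fun _ _ => x : Matrix Unit Unit R) := by fun_prop
  have hf : Continuous f :=
    h1.matrix_fromBlocks continuous_const continuous_const continuous_const
  obtain ⟨δ, hδ, h⟩ := Metric.isOpen_iff.mp (isOpen_isUnit.preimage hf) a hX
  obtain ⟨a', ha', hu⟩ := Metric.dense_iff.mp hd a δ hδ
  refine ⟨a', hu, ((((convex_ball a δ).isPathConnected ⟨a, Metric.mem_ball_self hδ⟩).joinedIn _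
    (Metric.mem_ball_self hδ) _ ha').map hf).mono ?_⟩
  rintro _ ⟨x, hx, rfl⟩
  exact h hx

theorem joinedIn_isUnit_of_equiv (e : m ≃ n)
    (hm : ∀ X : Matrix m m R, IsUnit X → JoinedIn {Z : Matrix m m R | IsUnit Z} X 1)
    (X : Matrix n n R) (hX : IsUnit X) : JoinedIn {Z : Matrix n n R | IsUnit Z} X 1 := by
  have h := (hm _ (hX.map (reindexAlgEquiv ℝ R e.symm))).isUnit_map
    (reindexAlgEquiv ℝ R e : Matrix m m R →* Matrix n n R) (by
      exact continuous_id.matrix_reindex e e)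
  have h2 : reindexAlgEquiv ℝ R e (reindexAlgEquiv ℝ R e.symm X) = X :=
    (reindexAlgEquiv ℝ R e).apply_symm_apply X
  simpa only [MonoidHom.coe_coe, h2, map_one] using h

theorem joinedIn_isUnit [CompleteSpace R] (hd : Dense {x : R | IsUnit x})
    (h1 : ∀ x : R, IsUnit x → JoinedIn {z : R | IsUnit z} x 1) (k : ℕ)
    (X : Matrix (Fin k) (Fin k) R) (hX : IsUnit X) :
    JoinedIn {Z : Matrix (Fin k) (Fin k) R | IsUnit Z} X 1 := by
  induction k with
  | zero => rw [Subsingleton.elim X 1]; exact JoinedIn.refl isUnit_one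
  | succ k ih =>
    let e : Unit ⊕ Fin k ≃ Fin (k + 1) :=
      (Equiv.sumComm _ _).trans ((Equiv.optionEquivSumPUnit _).symm.trans (finSuccEquiv k).symm)
    refine joinedIn_isUnit_of_equiv e (fun X hX => ?_) X hX
    have hX' : X = fromBlocks (of fun _ _ => X.toBlocks₁₁ () ()) X.toBlocks₁₂ X.toBlocks₂₁
        X.toBlocks₂₂ := (fromBlocks_toBlocks X).symm
    rw [hX'] at hX ⊢
    obtain ⟨a', ha', hj⟩ := exists_joinedIn_isUnit_fromBlocks hd hX
    refine hj.trans (joinedIn_isUnit_fromBlocks (joinedIn_isUnit_unit h1) ih hj.target_mem ?_)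
    exact ha'.map (uniqueRingEquiv : Matrix Unit Unit R ≃+* R).symm

end

end Matrix

theorem exists_polar_factor {M : Type*} [CStarAlgebra M] {y : M} (hy : IsUnit y) :
    ∃ r : M, y * (star r * r) ∈ unitary M ∧ star r * r * (star y * y) * (star r * r) = 1 := by
  let _ := CStarAlgebra.spectralOrder M
  let _ := CStarAlgebra.spectralOrderedRing M
  have ha : IsStrictlyPositive (star y * y) :=
    CStarAlgebra.isStrictlyPositive_iff_eq_star_mul_self.mpr ⟨y, hy, rfl⟩
  have hs0 : 0 ≤ (star y * y) ^ (-(1 / 2) : ℝ) := CFC.rpow_nonneg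
  have hsas := CFC.conjugate_rpow_neg_one_half (star y * y) ha
  obtain ⟨r, hr⟩ := CStarAlgebra.nonneg_iff_eq_star_mul_self.mp hs0
  rw [hr] at hsas
  refine ⟨r, ?_, hsas⟩
  have h1 : star (y * (star r * r)) * (y * (star r * r)) = 1 := by
    rw [← hsas]; simp [mul_assoc]
  have hu : IsUnit (star r * r) := by
    rw [← hr]; exact (CFC.isUnit_rpow_iff _ _ (by norm_num)).mpr ha.isUnit
  refine Unitary.mem_iff.mpr ⟨h1, ?_⟩
  rw [← (hy.mul hu).mul_left_inj, mul_assoc, h1, mul_one, one_mul]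

theorem joined_unitary_of_joinedIn_isUnit {M : Type*} [CStarAlgebra M] (u : unitary M)
    (h : JoinedIn {z : M | IsUnit z} 1 u) : Joined (1 : unitary M) u := by
  obtain ⟨γ, hγ⟩ := h
  let y : C(unitInterval, M) := γ.toContinuousMap
  obtain ⟨r, hw, hr⟩ := exists_polar_factor
    ((ContinuousMap.isUnit_iff_forall_isUnit y).mpr hγ)
  have hend : ∀ t, star (y t) * y t = 1 → y t * (star (r t) * r t) = y t := by
    intro t ht
    let _ := CStarAlgebra.spectralOrder M
    let _ := CStarAlgebra.spectralOrderedRing M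
    have h1 : (star (r t) * r t) * (star (r t) * r t) = 1 := by
      have := congrArg (fun f => f t) hr
      simpa [ht] using this
    rw [(CFC.sqrt_unique h1 (star_mul_self_nonneg _)).symm, CFC.sqrt_one, mul_one]
  have hmem : ∀ t, y t * (star (r t) * r t) ∈ unitary M := fun t =>
    Unitary.mem_iff.mpr ⟨congrArg (fun f => f t) (Unitary.mem_iff.mp hw).1,
      congrArg (fun f => f t) (Unitary.mem_iff.mp hw).2⟩
  have h0 : y 0 = 1 := γ.source
  have h1 : y 1 = u := γ.target
  refine ⟨⟨⟨fun t => ⟨_, hmem t⟩, Continuous.subtype_mk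
    (y * (star r * r) : C(unitInterval, M)).continuous _⟩, Subtype.ext ?_, Subtype.ext ?_⟩⟩
  · exact (hend 0 (by rw [h0]; simp)).trans h0
  · exact (hend 1 (by rw [h1]; simp)).trans h1

theorem SegmentApprox.k1Trivial {B : Type*} [NonUnitalCStarAlgebra B] (h : SegmentApprox B) :
    K1Trivial B := by
  intro n _ u
  let _ := CStarAlgebra.spectralOrder (Unitization ℂ B)
  let _ := CStarAlgebra.spectralOrderedRing (Unitization ℂ B)
  have hU : IsUnit u.1 := (Unitary.toUnits u).isUnit
  have hj := (Matrix.joinedIn_isUnit h.stableRankOne (fun x hx => h.joinedIn_isUnit hx) n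
    u.1 hU).symm
  have hJ : Joined (1 : unitary (Matrix (Fin n) (Fin n) (Unitization ℂ B))) u :=
    joined_unitary_of_joinedIn_isUnit (M := CStarMatrix (Fin n) (Fin n) (Unitization ℂ B)) u hj
  have hmem : ∀ v : unitary (Matrix (Fin n) (Fin n) (Unitization ℂ B)),
      Matrix.fromBlocks v.1 0 0 (1 : Matrix (Fin 0) (Fin 0) (Unitization ℂ B)) ∈
        unitary (Matrix (Fin n ⊕ Fin 0) (Fin n ⊕ Fin 0) (Unitization ℂ B)) := by
    intro v
    have h1 := Unitary.star_mul_self_of_mem v.2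
    have h2 := Unitary.mul_star_self_of_mem v.2
    rw [Matrix.star_eq_conjTranspose] at h1 h2
    rw [Unitary.mem_iff, Matrix.star_eq_conjTranspose, Matrix.fromBlocks_conjTranspose,
      Matrix.fromBlocks_multiply, Matrix.fromBlocks_multiply]
    simp [h1, h2]
  refine ⟨0, hmem u, ?_⟩
  have := hJ.map (f := fun v => (⟨_, hmem v⟩ :
    unitary (Matrix (Fin n ⊕ Fin 0) (Fin n ⊕ Fin 0) (Unitization ℂ B))))
    (Continuous.subtype_mk (continuous_subtype_val.matrix_fromBlocks continuous_const
      continuous_const continuous_const) _)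
  convert this using 1
  exact Subtype.ext Matrix.fromBlocks_one.symm

theorem stmt0 (A : Type*) [NonUnitalCStarAlgebra A]
    (h : StableRankOne C(unitInterval, A)) : NoK1Obstructions A := by
  refine ⟨(segmentApprox_of_hereditary h (NonUnitalStarAlgHom.id ℂ A) isometry_id
    fun b b' a => ⟨_, rfl⟩).stableRankOne, fun B _ hB => ?_⟩
  exact (segmentApprox_of_hereditary h (NonUnitalStarSubalgebraClass.subtype B)
    isometry_subtype_coe fun b b' a => ⟨⟨_, hB b b.2 a b' b'.2⟩, rfl⟩).k1Trivial
end
end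

section
/- Let A be a unital C*-algebra with no K₁-obstructions. For every ε > 0 there exists δ > 0 such that whenever a and b are invertible elements of A with ‖a‖ ≤ 1, ‖b‖ ≤ 1 and ‖a − b‖ < δ, there is a continuous path (c_t)_{t∈[0,1]} of invertible elements of A with c₀ = a, c₁ = b, and ‖c_t − a‖ < ε for all t ∈ [0,1]. -/
noncomputable section

set_option maxHeartbeats 1000000

open Filter Topology

/-- Two elements of a topological ring are joined by a path of units. -/
def UnitJoined {R : Type*} [Ring R] [TopologicalSpace R] (a b : R) : Prop :=
  JoinedIn {x : R | IsUnit x} a b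

def UnitsDense (R : Type*) [Ring R] [TopologicalSpace R] : Prop :=
  Dense {x : R | IsUnit x}

def UnitsLocallyJoined (R : Type*) [Ring R] [TopologicalSpace R] : Prop :=
  ∀ u : R, IsUnit u → ∀ᶠ x in 𝓝 u, UnitJoined u x

def UnitsCommuteUpToPath (R : Type*) [Ring R] [TopologicalSpace R] : Prop :=
  ∀ a b : R, IsUnit a → IsUnit b → UnitJoined (a * b) (b * a)

namespace UnitJoined

section TopologicalRing

variable {R : Type*} [Ring R] [TopologicalSpace R]

lemma refl {a : R} (ha : IsUnit a) : UnitJoined a a := JoinedIn.refl ha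

lemma symm {a b : R} (h : UnitJoined a b) : UnitJoined b a := JoinedIn.symm h

lemma trans {a b c : R} (h : UnitJoined a b) (h' : UnitJoined b c) : UnitJoined a c :=
  JoinedIn.trans h h'

lemma isUnit_left {a b : R} (h : UnitJoined a b) : IsUnit a := h.source_mem

lemma isUnit_right {a b : R} (h : UnitJoined a b) : IsUnit b := h.target_mem

lemma mul [IsTopologicalRing R] {a b c d : R} (h : UnitJoined a b) (h' : UnitJoined c d) :
    UnitJoined (a * c) (b * d) := by
  refine JoinedIn.mono (JoinedIn.mul h h') ?_
  rintro _ ⟨x, hx, y, hy, rfl⟩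
  exact IsUnit.mul hx hy

lemma of_continuous {a b : R} (f : ℝ → R) (hf : ContinuousOn f unitInterval)
    (h0 : f 0 = a) (h1 : f 1 = b) (h : ∀ t ∈ unitInterval, IsUnit (f t)) : UnitJoined a b := by
  subst h0 h1
  exact JoinedIn.ofLine hf rfl rfl (by rintro _ ⟨t, ht, rfl⟩; exact h t ht)

lemma map {S : Type*} [Ring S] [TopologicalSpace S] {a b : R} (h : UnitJoined a b) (f : R → S)
    (hf : Continuous f) (hu : ∀ x, IsUnit x → IsUnit (f x)) : UnitJoined (f a) (f b) :=
  (JoinedIn.map h hf).mono (by rintro _ ⟨x, hx, rfl⟩; exact hu x hx)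

end TopologicalRing

end UnitJoined

lemma unitsLocallyJoined_of_normedRing (R : Type*) [NormedRing R] [CompleteSpace R]
    [NormedSpace ℝ R] : UnitsLocallyJoined R := by
  rintro _ ⟨u, rfl⟩
  obtain ⟨ε, hε, h⟩ := Metric.isOpen_iff.1 (Units.isOpen (R := R)) u u.isUnit
  filter_upwards [Metric.ball_mem_nhds (u : R) hε] with x hx
  exact ((convex_ball (u : R) ε).isPathConnected ⟨_, hx⟩).joinedIn _ (Metric.mem_ball_self hε) _ hx
    |>.mono h

section Step

variable {R : Type*} [Ring R] [TopologicalSpace R] [IsTopologicalRing R]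

lemma UnitJoined.one_add_mul_swap (hd : UnitsDense R) (hl : UnitsLocallyJoined R)
    (hc : UnitsCommuteUpToPath R) {r b : R} (h : IsUnit (1 + r * b)) (h' : IsUnit (1 + b * r)) :
    UnitJoined (1 + r * b) (1 + b * r) := by
  have c1 : ContinuousAt (fun x : R => 1 + r * x) b := by fun_prop
  have c2 : ContinuousAt (fun x : R => 1 + x * r) b := by fun_prop
  have e1 := c1.eventually (hl _ h)
  have e2 := c2.eventually (hl _ h')
  obtain ⟨x, hx, h1, h2⟩ :=
    ((mem_closure_iff_frequently.1 (hd b)).and_eventually (e1.and e2)).exists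
  obtain ⟨v, rfl⟩ := hx
  have key : (1 + r * (v : R)) = (↑v⁻¹ : R) * ((1 + v * r) * v) := by
    rw [add_mul, mul_add, ← mul_assoc, ← mul_assoc, ← mul_assoc]; simp
  have := hc (↑v⁻¹ : R) ((1 + v * r) * v) v⁻¹.isUnit (h2.isUnit_right.mul v.isUnit)
  rw [← key, mul_assoc, Units.mul_inv, mul_one] at this
  exact h1.trans (this.trans h2.symm)

end Step

section SchurComplement

variable {R : Type*} [Ring R]

lemma isUnit_one_add_mul_swap {a b : R} (h : IsUnit (1 + a * b)) : IsUnit (1 + b * a) := by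
  obtain ⟨u, hu⟩ := h
  have h1 : (1 + a * b) * (↑u⁻¹ : R) = 1 := by rw [← hu, Units.mul_inv]
  have h2 : (↑u⁻¹ : R) * (1 + a * b) = 1 := by rw [← hu, Units.inv_mul]
  refine ⟨⟨1 + b * a, 1 - b * ↑u⁻¹ * a, ?_, ?_⟩, rfl⟩
  · calc (1 + b * a) * (1 - b * ↑u⁻¹ * a) = 1 + b * a - b * ((1 + a * b) * ↑u⁻¹) * a := by
          noncomm_ring
      _ = 1 := by rw [h1]; noncomm_ring
  · calc (1 - b * ↑u⁻¹ * a) * (1 + b * a) = 1 + b * a - b * (↑u⁻¹ * (1 + a * b)) * a := by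
          noncomm_ring
      _ = 1 := by rw [h2]; noncomm_ring

lemma one_add_mul_schur_complement (s d y : Rˣ) (r a b c : R)
    (hy : (y : R) = 1 + ↑s⁻¹ * r * (b * ↑d⁻¹)) :
    (1 + b * ↑d⁻¹ * (↑s⁻¹ * r)) * (a - b * ↑(y * d)⁻¹ * (c + ↑s⁻¹ * r * a)) =
      a - b * ↑d⁻¹ * c := by
  generalize hρ : (↑s⁻¹ : R) * r = ρ at *
  generalize hβ : b * (↑d⁻¹ : R) = β at *
  have h1 : b * (↑(y * d)⁻¹ : R) = β * ↑y⁻¹ := by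
    rw [mul_inv_rev, Units.val_mul, ← mul_assoc, hβ]
  have h2 : (1 + ρ * β) * (↑y⁻¹ : R) = 1 := by rw [← hy, Units.mul_inv]
  calc (1 + β * ρ) * (a - b * ↑(y * d)⁻¹ * (c + ρ * a))
      = a + β * ρ * a - β * ((1 + ρ * β) * ↑y⁻¹) * (c + ρ * a) := by rw [h1]; noncomm_ring
    _ = a - β * c := by rw [h2]; noncomm_ring

lemma schur_complement_mul (s d y : Rˣ) (p q r a b c : R)
    (hy : (y : R) = 1 + ↑s⁻¹ * r * (b * ↑d⁻¹)) :
    p * a + q * c - (p * b + q * d) * ↑(s * y * d)⁻¹ * (r * a + s * c) =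
      (p - q * ↑s⁻¹ * r) * (a - b * ↑(y * d)⁻¹ * (c + ↑s⁻¹ * r * a)) := by
  have h1 : (↑(s * y * d)⁻¹ : R) * (r * a + s * c) = ↑(y * d)⁻¹ * (c + ↑s⁻¹ * r * a) := by
    rw [mul_assoc s, mul_inv_rev s, Units.val_mul, mul_assoc, mul_add, ← mul_assoc (↑s⁻¹ : R) (↑s),
      Units.inv_mul, one_mul, add_comm, mul_assoc (↑s⁻¹ : R)]
  have h2 : (↑d + ↑s⁻¹ * r * b) * (↑(y * d)⁻¹ : R) = 1 := by
    have : (↑d + ↑s⁻¹ * r * b : R) = ↑(y * d) := by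
      rw [Units.val_mul, hy, add_mul, one_mul, mul_assoc _ (b * _), mul_assoc b, Units.inv_mul, mul_one]
    rw [this, Units.mul_inv]
  rw [mul_assoc (p * b + q * d), h1]
  generalize (↑(y * d)⁻¹ : R) = z at *
  generalize (↑s⁻¹ : R) = w at *
  have : p * a + q * c - (p * b + q * ↑d) * (z * (c + w * r * a)) =
      (p - q * w * r) * (a - b * z * (c + w * r * a)) + q * (c + w * r * a) -
        q * ((↑d + w * r * b) * z) * (c + w * r * a) := by noncomm_ring
  rw [this, h2]
  noncomm_ring

lemma UnitJoined.schur_mul {R : Type*} [Ring R] [TopologicalSpace R] [IsTopologicalRing R]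
    (hd : UnitsDense R) (hl : UnitsLocallyJoined R)
    (hc : UnitsCommuteUpToPath R) (s d e : Rˣ) (p q r a b c : R)
    (he : (e : R) = r * b + s * d) (hs : UnitJoined (s : R) 1)
    (ht : UnitJoined (p - q * ↑s⁻¹ * r) 1) (hσ : IsUnit (a - b * ↑d⁻¹ * c)) :
    UnitJoined
      ((p * a + q * c - (p * b + q * d) * ↑e⁻¹ * (r * a + s * c)) * e)
      ((a - b * ↑d⁻¹ * c) * d) := by
  set y : Rˣ := s⁻¹ * e * d⁻¹ with hy'
  have hy : (y : R) = 1 + ↑s⁻¹ * r * (b * ↑d⁻¹) := by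
    rw [hy', Units.val_mul, Units.val_mul, he, mul_add, add_mul, ← mul_assoc (↑s⁻¹ : R) (s : R),
      Units.inv_mul, one_mul, Units.mul_inv, add_comm]
    simp only [mul_assoc]
  have hE : e = s * y * d := by rw [hy']; group
  rw [hE, schur_complement_mul s d y p q r a b c hy]
  have key := one_add_mul_schur_complement s d y r a b c hy
  set τ := a - b * ↑(y * d)⁻¹ * (c + ↑s⁻¹ * r * a)
  have hY : IsUnit (1 + ↑s⁻¹ * r * (b * ↑d⁻¹)) := hy ▸ y.isUnit
  have hX := isUnit_one_add_mul_swap hY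
  have hτ : IsUnit τ := by
    obtain ⟨x, hx⟩ := hX
    rw [← hx] at key
    rw [← key] at hσ
    exact (Units.isUnit_units_mul x τ).1 hσ
  have hXY := UnitJoined.one_add_mul_swap hd hl hc hY hX
  rw [← hy] at hXY
  have d1 : UnitJoined ((p - q * ↑s⁻¹ * r) * τ * ↑(s * y * d))
      (1 * τ * (1 * (1 + b * ↑d⁻¹ * (↑s⁻¹ * r)) * d)) := by
    rw [Units.val_mul, Units.val_mul]
    exact (ht.mul (.refl hτ)).mul ((hs.mul hXY).mul (.refl d.isUnit))
  refine d1.trans ?_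
  rw [one_mul, one_mul, ← mul_assoc, ← key]
  exact (hc _ _ hτ hX).mul (.refl d.isUnit)

end SchurComplement

section BlockMatrix

set_option linter.unusedSectionVars false

open Matrix

variable {A : Type*} {T : Type*} [Fintype T] [DecidableEq T]

section Ring

variable [Ring A]

@[simp] lemma Matrix.toBlocks₁₁_one : (1 : Matrix (T ⊕ T) (T ⊕ T) A).toBlocks₁₁ = 1 := by
  rw [← fromBlocks_one, toBlocks_fromBlocks₁₁]

@[simp] lemma Matrix.toBlocks₁₂_one : (1 : Matrix (T ⊕ T) (T ⊕ T) A).toBlocks₁₂ = 0 := by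
  rw [← fromBlocks_one, toBlocks_fromBlocks₁₂]

@[simp] lemma Matrix.toBlocks₂₁_one : (1 : Matrix (T ⊕ T) (T ⊕ T) A).toBlocks₂₁ = 0 := by
  rw [← fromBlocks_one, toBlocks_fromBlocks₂₁]

@[simp] lemma Matrix.toBlocks₂₂_one : (1 : Matrix (T ⊕ T) (T ⊕ T) A).toBlocks₂₂ = 1 := by
  rw [← fromBlocks_one, toBlocks_fromBlocks₂₂]

lemma Matrix.fromBlocks_eq_schur (a b c : Matrix T T A) (d : (Matrix T T A)ˣ) :
    fromBlocks a b c (d : Matrix T T A) =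
      fromBlocks 1 (b * (↑d⁻¹ : Matrix T T A)) 0 1 *
        fromBlocks (a - b * (↑d⁻¹ : Matrix T T A) * c) 0 0 (d : Matrix T T A) *
        fromBlocks 1 0 ((↑d⁻¹ : Matrix T T A) * c) 1 := by
  simp [fromBlocks_multiply, mul_assoc]

lemma Matrix.isUnit_fromBlocks_upper (b : Matrix T T A) :
    IsUnit (fromBlocks 1 b 0 1 : Matrix (T ⊕ T) (T ⊕ T) A) :=
  ⟨⟨fromBlocks 1 b 0 1, fromBlocks 1 (-b) 0 1, by simp [fromBlocks_multiply, fromBlocks_one],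
    by simp [fromBlocks_multiply, fromBlocks_one]⟩, rfl⟩

lemma Matrix.isUnit_fromBlocks_lower (b : Matrix T T A) :
    IsUnit (fromBlocks 1 0 b 1 : Matrix (T ⊕ T) (T ⊕ T) A) :=
  ⟨⟨fromBlocks 1 0 b 1, fromBlocks 1 0 (-b) 1, by simp [fromBlocks_multiply, fromBlocks_one],
    by simp [fromBlocks_multiply, fromBlocks_one]⟩, rfl⟩

lemma Matrix.isUnit_fromBlocks_diagonal {S : Type*} [Fintype S] [DecidableEq S]
    {a : Matrix T T A} {d : Matrix S S A} :
    IsUnit (fromBlocks a 0 0 d : Matrix (T ⊕ S) (T ⊕ S) A) ↔ IsUnit a ∧ IsUnit d := by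
  constructor
  · rintro ⟨u, hu⟩
    have h1 := u.mul_inv
    have h2 := u.inv_mul
    rw [hu, ← fromBlocks_toBlocks (↑u⁻¹ : Matrix (T ⊕ S) (T ⊕ S) A), fromBlocks_multiply,
      ← fromBlocks_one, fromBlocks_inj] at h1 h2
    simp only [Matrix.zero_mul, Matrix.mul_zero, add_zero, zero_add] at h1 h2
    exact ⟨⟨⟨a, _, h1.1, h2.1⟩, rfl⟩, ⟨⟨d, _, h1.2.2.2, h2.2.2.2⟩, rfl⟩⟩
  · rintro ⟨⟨u, rfl⟩, ⟨v, rfl⟩⟩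
    exact ⟨⟨fromBlocks (u : Matrix T T A) 0 0 (v : Matrix S S A), fromBlocks (↑u⁻¹ : Matrix T T A) 0 0 (↑v⁻¹ : Matrix S S A),
      by simp [fromBlocks_multiply, fromBlocks_one],
      by simp [fromBlocks_multiply, fromBlocks_one]⟩, rfl⟩

lemma Matrix.isUnit_fromBlocks_iff_schur (a b c : Matrix T T A) (d : (Matrix T T A)ˣ) :
    IsUnit (fromBlocks a b c (d : Matrix T T A)) ↔
      IsUnit (a - b * (↑d⁻¹ : Matrix T T A) * c) := by
  rw [fromBlocks_eq_schur]
  obtain ⟨x, hx⟩ := isUnit_fromBlocks_upper (b * (↑d⁻¹ : Matrix T T A))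
  obtain ⟨y, hy⟩ := isUnit_fromBlocks_lower ((↑d⁻¹ : Matrix T T A) * c)
  rw [← hx, ← hy, Units.isUnit_mul_units, Units.isUnit_units_mul, isUnit_fromBlocks_diagonal]
  simp

/-- The product of the Schur complement of the lower right block with this block. -/
noncomputable def Matrix.blockDet (x : Matrix (T ⊕ T) (T ⊕ T) A) : Matrix T T A :=
  (x.toBlocks₁₁ - x.toBlocks₁₂ * Ring.inverse x.toBlocks₂₂ * x.toBlocks₂₁) * x.toBlocks₂₂

end Ring

section Topological

variable [Ring A] [TopologicalSpace A] [IsTopologicalRing A]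

lemma unitsDense_fromBlocks (hd : UnitsDense (Matrix T T A)) :
    UnitsDense (Matrix (T ⊕ T) (T ⊕ T) A) := by
  have h1 (a b c : Matrix T T A) (d : Matrix T T A) (h : IsUnit d) :
      fromBlocks a b c d ∈ closure {x : Matrix (T ⊕ T) (T ⊕ T) A | IsUnit x} := by
    obtain ⟨d, rfl⟩ := h
    have hc : Continuous fun x : Matrix T T A =>
        fromBlocks (x + b * (↑d⁻¹ : Matrix T T A) * c) b c (d : Matrix T T A) := by
      refine Continuous.matrix_fromBlocks ?_ ?_ ?_ ?_ <;> fun_prop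
    have := map_mem_closure hc (hd (a - b * (↑d⁻¹ : Matrix T T A) * c))
      (t := {x | IsUnit x}) (fun x hx => ?_)
    · simpa using this
    · exact (isUnit_fromBlocks_iff_schur _ _ _ _).2 (by simpa using hx)
  intro g
  rw [← fromBlocks_toBlocks g, ← closure_closure]
  have hc : Continuous fun x : Matrix T T A =>
      fromBlocks g.toBlocks₁₁ g.toBlocks₁₂ g.toBlocks₂₁ x := by
    refine Continuous.matrix_fromBlocks ?_ ?_ ?_ ?_ <;> fun_prop
  exact map_mem_closure hc (hd g.toBlocks₂₂) (fun x hx => h1 _ _ _ _ hx)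

lemma dense_isUnit_toBlocks₂₂ (hd : UnitsDense (Matrix T T A)) :
    Dense {x : Matrix (T ⊕ T) (T ⊕ T) A | IsUnit x.toBlocks₂₂} := by
  intro g
  rw [← fromBlocks_toBlocks g]
  have hc : Continuous fun x : Matrix T T A =>
      fromBlocks g.toBlocks₁₁ g.toBlocks₁₂ g.toBlocks₂₁ x := by
    refine Continuous.matrix_fromBlocks ?_ ?_ ?_ ?_ <;> fun_prop
  exact map_mem_closure hc (hd g.toBlocks₂₂) (fun x hx => by simpa using hx)

lemma blockDet_joined (hd : UnitsDense (Matrix T T A)) (hl : UnitsLocallyJoined (Matrix T T A))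
    (hc : UnitsCommuteUpToPath (Matrix T T A)) {x z : Matrix (T ⊕ T) (T ⊕ T) A}
    (hx : IsUnit x) (hs : UnitJoined z.toBlocks₂₂ 1)
    (ht : UnitJoined (z.toBlocks₁₁ - z.toBlocks₁₂ * Ring.inverse z.toBlocks₂₂ * z.toBlocks₂₁) 1)
    (h1 : IsUnit x.toBlocks₂₂) (h2 : IsUnit (z * x).toBlocks₂₂) :
    UnitJoined (z * x).blockDet x.blockDet := by
  obtain ⟨p, q, r, s, rfl⟩ : ∃ p q r s, z = fromBlocks p q r s :=
    ⟨_, _, _, _, (fromBlocks_toBlocks z).symm⟩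
  obtain ⟨a, b, c, d, rfl⟩ : ∃ a b c d, x = fromBlocks a b c d :=
    ⟨_, _, _, _, (fromBlocks_toBlocks x).symm⟩
  simp only [blockDet, fromBlocks_multiply, toBlocks_fromBlocks₁₁, toBlocks_fromBlocks₁₂,
    toBlocks_fromBlocks₂₁, toBlocks_fromBlocks₂₂] at *
  obtain ⟨s, rfl⟩ := hs.isUnit_left
  obtain ⟨d, rfl⟩ := h1
  obtain ⟨e, he⟩ := h2
  rw [← he]
  simp only [Ring.inverse_unit] at *
  exact UnitJoined.schur_mul hd hl hc s d e p q r a b c he hs ht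
    ((isUnit_fromBlocks_iff_schur _ _ _ _).1 hx)

lemma UnitJoined.of_fromBlocks (hd : UnitsDense (Matrix T T A))
    (hl : UnitsLocallyJoined (Matrix T T A)) (hc : UnitsCommuteUpToPath (Matrix T T A))
    (hi : ContinuousAt Ring.inverse (1 : Matrix T T A))
    (hi' : ∀ g : Matrix (T ⊕ T) (T ⊕ T) A, IsUnit g → ContinuousAt Ring.inverse g)
    (hl' : UnitsLocallyJoined (Matrix (T ⊕ T) (T ⊕ T) A)) {u : Matrix T T A}
    (h : UnitJoined (fromBlocks u 0 0 1 : Matrix (T ⊕ T) (T ⊕ T) A) 1) : UnitJoined u 1 := by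
  let Q (x y : Matrix (T ⊕ T) (T ⊕ T) A) : Prop :=
    IsUnit x.toBlocks₂₂ → IsUnit y.toBlocks₂₂ → UnitJoined x.blockDet y.blockDet
  let P (g g' : Matrix (T ⊕ T) (T ⊕ T) A) : Prop := ∀ᶠ p in 𝓝 (g, g'), Q p.1 p.2
  have hloc (g : Matrix (T ⊕ T) (T ⊕ T) A) (hg : IsUnit g) : P g g := by
    let z (p : Matrix (T ⊕ T) (T ⊕ T) A × Matrix (T ⊕ T) (T ⊕ T) A) := p.2 * Ring.inverse p.1
    have hz1 : z (g, g) = 1 := Ring.mul_inverse_cancel g hg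
    have hz : ContinuousAt z (g, g) := by
      have : ContinuousAt (fun p : Matrix (T ⊕ T) (T ⊕ T) A × Matrix (T ⊕ T) (T ⊕ T) A =>
          Ring.inverse p.1) (g, g) :=
        ContinuousAt.comp (g := Ring.inverse) (f := Prod.fst) (x := (g, g)) (hi' g hg)
          continuousAt_fst
      exact continuousAt_snd.mul this
    have z22 : ContinuousAt (fun p => (z p).toBlocks₂₂) (g, g) :=
      ContinuousAt.comp (g := toBlocks₂₂) (by
        exact (continuous_id.matrix_submatrix Sum.inr Sum.inr).continuousAt) hz
    have z11 : ContinuousAt (fun p => (z p).toBlocks₁₁) (g, g) :=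
      ContinuousAt.comp (g := toBlocks₁₁) (by
        exact (continuous_id.matrix_submatrix Sum.inl Sum.inl).continuousAt) hz
    have z12 : ContinuousAt (fun p => (z p).toBlocks₁₂) (g, g) :=
      ContinuousAt.comp (g := toBlocks₁₂) (by
        exact (continuous_id.matrix_submatrix Sum.inl Sum.inr).continuousAt) hz
    have z21 : ContinuousAt (fun p => (z p).toBlocks₂₁) (g, g) :=
      ContinuousAt.comp (g := toBlocks₂₁) (by
        exact (continuous_id.matrix_submatrix Sum.inr Sum.inl).continuousAt) hz
    have e : (z (g, g)).toBlocks₂₂ = 1 := by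
      rw [hz1, toBlocks₂₂_one]
    have zi : ContinuousAt (fun p => Ring.inverse (z p).toBlocks₂₂) (g, g) :=
      ContinuousAt.comp (g := Ring.inverse) (by rwa [e]) z22
    have ht := z11.sub ((z12.mul zi).mul z21)
    have e' : (z (g, g)).toBlocks₁₁ - (z (g, g)).toBlocks₁₂ *
        Ring.inverse (z (g, g)).toBlocks₂₂ * (z (g, g)).toBlocks₂₁ = 1 := by
      rw [e, hz1]
      simp
    have H1 := z22.eventually (p := UnitJoined 1) (by
      change ∀ᶠ _ in 𝓝 (z (g, g)).toBlocks₂₂, _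
      rw [e]; exact hl 1 isUnit_one)
    have H2 := ht.eventually (p := UnitJoined 1) (by
      change ∀ᶠ _ in 𝓝 ((z (g, g)).toBlocks₁₁ - (z (g, g)).toBlocks₁₂ *
        Ring.inverse (z (g, g)).toBlocks₂₂ * (z (g, g)).toBlocks₂₁), _
      rw [e']; exact hl 1 isUnit_one)
    have H3 : ∀ᶠ p in 𝓝 (g, g), UnitJoined g p.1 :=
      (continuousAt_fst (p := (g, g))).eventually (hl' g hg)
    filter_upwards [H1, H2, H3] with p h1 h2 h3 hu1 hu2
    have hzx : z p * p.1 = p.2 := by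
      simp only [z]
      rw [mul_assoc, Ring.inverse_mul_cancel _ h3.isUnit_right, mul_one]
    have := blockDet_joined hd hl hc (x := p.1) (z := z p) h3.isUnit_right h1.symm h2.symm hu1
      (by rwa [hzx])
    rw [hzx] at this
    exact this.symm
  have hsymm (g g' : Matrix (T ⊕ T) (T ⊕ T) A) (hg : P g g') : P g' g := by
    have := (continuous_swap.tendsto (g', g)).eventually hg
    filter_upwards [this] with p hp h1 h2
    exact (hp h2 h1).symm
  have htrans (g₁ g₂ g₃ : Matrix (T ⊕ T) (T ⊕ T) A) (h12 : P g₁ g₂) (h23 : P g₂ g₃) : P g₁ g₃ := by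
    have h12' : {p : Matrix (T ⊕ T) (T ⊕ T) A × Matrix (T ⊕ T) (T ⊕ T) A | Q p.1 p.2} ∈
        𝓝 (g₁, g₂) := h12
    have h23' : {p : Matrix (T ⊕ T) (T ⊕ T) A × Matrix (T ⊕ T) (T ⊕ T) A | Q p.1 p.2} ∈
        𝓝 (g₂, g₃) := h23
    obtain ⟨U, hU, V, hV, h1⟩ := mem_nhds_prod_iff.1 h12'
    obtain ⟨V', hV', W, hW, h2⟩ := mem_nhds_prod_iff.1 h23'
    obtain ⟨y, ⟨hy, hy'⟩, hyu⟩ :=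
      mem_closure_iff_nhds.1 (dense_isUnit_toBlocks₂₂ hd g₂) _ (inter_mem hV hV')
    filter_upwards [prod_mem_nhds hU hW] with p hp hp1 hp2
    exact (h1 (Set.mk_mem_prod hp.1 hy) hp1 hyu).trans (h2 (Set.mk_mem_prod hy' hp.2) hyu hp2)
  obtain ⟨γ, hγ⟩ := h
  have key : P (γ 0) (γ 1) := by
    refine PreconnectedSpace.induction₂' (fun s t : unitInterval => P (γ s) (γ t)) (fun s => ?_)
      ⟨fun _ _ _ => htrans _ _ _⟩ 0 1
    have h1 : ∀ᶠ p in 𝓝 (γ s, γ s), ∀ᶠ p' in 𝓝 p, Q p'.1 p'.2 :=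
      eventually_eventually_nhds.2 (hloc _ (hγ s))
    have h2 : ContinuousAt (fun t => (γ s, γ t)) s := by fun_prop
    filter_upwards [h2.eventually h1] with t ht
    exact ⟨ht, hsymm _ _ ht⟩
  rw [γ.source, γ.target] at key
  have := key.self_of_nhds (by simp) (by simp)
  simpa [blockDet] using this

end Topological

end BlockMatrix

section PolarDecomposition

variable {R : Type*} [CStarAlgebra R]

lemma UnitJoined.commute_of_joined {a a' b b' : R} (ha : UnitJoined a a') (hb : UnitJoined b b')
    (h : UnitJoined (a' * b') (b' * a')) : UnitJoined (a * b) (b * a) :=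
  ((ha.mul hb).trans h).trans (hb.symm.mul ha.symm)

variable [PartialOrder R] [StarOrderedRing R]

lemma isUnit_cfcAbs {z : R} (hz : IsUnit z) : IsUnit (CFC.abs z) := by
  rw [CFC.abs, CFC.isUnit_sqrt_iff _ (star_mul_self_nonneg z)]
  exact hz.star.mul hz

def unitaryPart (z : R) : R := z * Ring.inverse (CFC.abs z)

lemma unitaryPart_mul_abs {z : R} (hz : IsUnit z) : unitaryPart z * CFC.abs z = z := by
  rw [unitaryPart, mul_assoc, Ring.inverse_mul_cancel _ (isUnit_cfcAbs hz), mul_one]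

lemma isUnit_unitaryPart {z : R} (hz : IsUnit z) : IsUnit (unitaryPart z) :=
  hz.mul (isUnit_cfcAbs hz).ringInverse

lemma unitaryPart_mem_unitary {z : R} (hz : IsUnit z) : unitaryPart z ∈ unitary R := by
  have h1 : star (unitaryPart z) * unitaryPart z = 1 := by
    have hs : star (Ring.inverse (CFC.abs z)) = Ring.inverse (CFC.abs z) := by
      rw [← Ring.inverse_star, (CFC.abs_nonneg z).isSelfAdjoint.star_eq]
    rw [unitaryPart, star_mul, hs, mul_assoc, ← mul_assoc (star z), ← CFC.abs_mul_abs z,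
      mul_assoc, Ring.mul_inverse_cancel _ (isUnit_cfcAbs hz), mul_one,
      Ring.inverse_mul_cancel _ (isUnit_cfcAbs hz)]
  refine ⟨h1, ?_⟩
  obtain ⟨u, hu⟩ := isUnit_unitaryPart hz
  rw [← hu] at h1 ⊢
  rw [Units.mul_eq_one_iff_eq_inv.1 h1, Units.mul_inv]

lemma continuousAt_unitaryPart {z : R} (hz : IsUnit z) : ContinuousAt unitaryPart z := by
  refine continuousAt_id.mul ?_
  obtain ⟨u, hu⟩ := isUnit_cfcAbs hz
  refine ContinuousAt.comp (g := Ring.inverse) ?_ CFC.continuous_abs.continuousAt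
  rw [← hu]
  exact NormedRing.inverse_continuousAt u

lemma UnitJoined.of_isStrictlyPositive {h : R} (hh : IsStrictlyPositive h) : UnitJoined h 1 := by
  refine UnitJoined.of_continuous (fun t => (1 - t) • h + t • 1) (by fun_prop) (by simp) (by simp) ?_
  rintro t ⟨h0, h1⟩
  rcases h1.eq_or_lt with rfl | h1
  · simp
  · have : IsStrictlyPositive ((1 - t) • h) := hh.smul (by linarith)
    exact (this.add_nonneg (smul_nonneg h0 zero_le_one)).isUnit

lemma isStrictlyPositive_cfcAbs {z : R} (hz : IsUnit z) : IsStrictlyPositive (CFC.abs z) :=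
  (isUnit_cfcAbs hz).isStrictlyPositive (CFC.abs_nonneg z)

lemma UnitJoined.unitaryPart {z : R} (hz : IsUnit z) : UnitJoined z (unitaryPart z) := by
  have := (UnitJoined.refl (isUnit_unitaryPart hz)).mul
    (UnitJoined.of_isStrictlyPositive (isStrictlyPositive_cfcAbs hz))
  rwa [unitaryPart_mul_abs hz, mul_one] at this

lemma norm_sub_one_mul_le {h : R} (hh : 0 ≤ h) (f : R) :
    ‖(h - 1) * f‖ ≤ ‖(h * h - 1) * f‖ := by
  have hc : ContinuousOn (fun x : ℝ => (x + 1)⁻¹) (spectrum ℝ h) :=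
    ContinuousOn.inv₀ (by fun_prop) fun x hx => by
      have := spectrum_nonneg_of_nonneg hh hx
      positivity
  have hk : cfc (fun x : ℝ => (x + 1)⁻¹) h * (h + 1) = 1 := by
    have : h + 1 = cfc (fun x : ℝ => x + 1) h := by
      rw [cfc_add .., cfc_id' .., cfc_const_one ..]
    rw [this, ← cfc_mul .., ← cfc_one ℝ h]
    refine cfc_congr fun x hx => ?_
    have := spectrum_nonneg_of_nonneg hh hx
    have : x + 1 ≠ 0 := by positivity
    simp [this]
  have hn : ‖cfc (fun x : ℝ => (x + 1)⁻¹) h‖ ≤ 1 := by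
    refine norm_cfc_le zero_le_one fun x hx => ?_
    have := spectrum_nonneg_of_nonneg hh hx
    rw [Real.norm_of_nonneg (by positivity)]
    exact inv_le_one_of_one_le₀ (by linarith)
  have : (h - 1) * f = cfc (fun x : ℝ => (x + 1)⁻¹) h * ((h * h - 1) * f) := by
    have : h * h - 1 = (h + 1) * (h - 1) := by noncomm_ring
    rw [this, mul_assoc, ← mul_assoc (cfc _ _), hk, one_mul]
  rw [this]
  exact (norm_mul_le _ _).trans (mul_le_of_le_one_left (norm_nonneg _) hn)

lemma norm_unitaryPart_mul_sub_le {z : R} (hz : IsUnit z) (f : R) :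
    ‖unitaryPart z * f - f‖ ≤ ‖z * f - f‖ + ‖star z * z * f - f‖ := by
  have h1 : unitaryPart z * f - f = (z * f - f) - unitaryPart z * ((CFC.abs z - 1) * f) := by
    rw [← mul_assoc, mul_sub, unitaryPart_mul_abs hz]
    noncomm_ring
  have h2 := CStarRing.norm_coe_unitary_mul ⟨_, unitaryPart_mem_unitary hz⟩
    ((CFC.abs z - 1) * f)
  have h3 := norm_sub_one_mul_le (CFC.abs_nonneg z) f
  rw [CFC.abs_mul_abs, sub_mul (star z * z), one_mul] at h3
  rw [h1]
  exact (norm_sub_le _ _).trans (by simpa using h2.le.trans h3)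

end PolarDecomposition

section Cutoff

variable {R : Type*} [CStarAlgebra R]

/-- The piecewise linear function equal to `1` where `10 * σ * re z ≤ n - 1` and to `0` where
`10 * σ * re z ≥ n`. -/
def cutoffFun (σ n : ℝ) (z : ℂ) : ℂ := ((max 0 (min 1 (n - 10 * (σ * z.re))) : ℝ) : ℂ)

/-- The spectral cutoff of a unitary associated with `cutoffFun`. -/
def cutoff (v : R) (σ n : ℝ) : R := cfc (cutoffFun σ n) v

@[fun_prop]
lemma continuous_cutoffFun (σ n : ℝ) : Continuous (cutoffFun σ n) := by
  unfold cutoffFun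
  fun_prop

lemma cutoffFun_eq_zero {σ n : ℝ} {z : ℂ} (h : n ≤ 10 * (σ * z.re)) : cutoffFun σ n z = 0 := by
  have : max 0 (min 1 (n - 10 * (σ * z.re))) = 0 :=
    max_eq_left ((min_le_right _ _).trans (by linarith))
  simp only [cutoffFun, this, Complex.ofReal_zero]

lemma cutoffFun_eq_one {σ n : ℝ} {z : ℂ} (h : 10 * (σ * z.re) ≤ n - 1) : cutoffFun σ n z = 1 := by
  have : max 0 (min 1 (n - 10 * (σ * z.re))) = 1 := by
    rw [min_eq_left (by linarith), max_eq_right zero_le_one]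
  simp only [cutoffFun, this, Complex.ofReal_one]

lemma cutoff_mul_cutoff_of_le (v : R) [IsStarNormal v] {σ n m : ℝ} (h : n + 1 ≤ m) :
    cutoff v σ n * cutoff v σ m = cutoff v σ n := by
  rw [cutoff, cutoff, ← cfc_mul ..]
  congr 1
  ext z
  rcases le_total n (10 * (σ * z.re)) with h1 | h1
  · rw [cutoffFun_eq_zero h1, zero_mul]
  · rw [cutoffFun_eq_one (n := m) (by linarith), mul_one]

lemma cutoff_mul_cutoff_eq_zero (v : R) [IsStarNormal v] {n m : ℝ} (h : n + m ≤ 0) :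
    cutoff v (-1) n * cutoff v 1 m = 0 := by
  rw [cutoff, cutoff, ← cfc_mul .., ← cfc_zero ℂ v]
  congr 1
  ext z
  rcases le_total n (10 * (-1 * z.re)) with h1 | h1
  · rw [cutoffFun_eq_zero h1, zero_mul]; rfl
  · rw [cutoffFun_eq_zero (n := m) (by linarith), mul_zero]; rfl

lemma cutoff_commute (v : R) (σ n σ' m : ℝ) : Commute (cutoff v σ n) (cutoff v σ' m) :=
  cfc_commute_cfc ..

lemma isSelfAdjoint_cutoff (v : R) (σ n : ℝ) : IsSelfAdjoint (cutoff v σ n) := by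
  rw [IsSelfAdjoint, cutoff, ← cfc_star]
  congr 1
  ext z
  simp [cutoffFun]

/-- A unitary is joined to a unit which agrees with the scalar `σ = ±1` off the support of a
cutoff. -/
lemma exists_joined_eq_off_cutoff {v : R} (hv : v ∈ unitary R) {σ : ℝ} (hσ : σ = 1 ∨ σ = -1) :
    ∃ v' : R, UnitJoined v v' ∧ cutoff v σ (-3) * (v' - (σ : ℂ) • 1) = v' - (σ : ℂ) • 1 ∧
      (v' - (σ : ℂ) • 1) * cutoff v σ (-3) = v' - (σ : ℂ) • 1 := by
  have hn : IsStarNormal v := ⟨hv.1.trans hv.2.symm⟩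
  have hsub : v - (σ : ℂ) • 1 = cfc (fun z : ℂ => z - σ) v := by
    rw [cfc_sub .., cfc_id' .., cfc_const .., Algebra.algebraMap_eq_smul_one]
  have hval : v + (1 - cutoff v σ (-4)) * ((σ : ℂ) • 1 - v) - (σ : ℂ) • 1 =
      cutoff v σ (-4) * (v - (σ : ℂ) • 1) := by
    simp only [sub_mul, mul_sub, one_mul]
    abel
  have hk := cutoff_mul_cutoff_of_le v (σ := σ) (n := -4) (m := -3) (by norm_num)
  have hcomm : Commute (v - (σ : ℂ) • 1) (cutoff v σ (-3)) := by
    rw [hsub]; exact cfc_commute_cfc ..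
  refine ⟨v + (1 - cutoff v σ (-4)) * ((σ : ℂ) • 1 - v), ?_, ?_, ?_⟩
  · refine UnitJoined.of_continuous
      (fun t => v + (t : ℂ) • ((1 - cutoff v σ (-4)) * ((σ : ℂ) • 1 - v))) (by fun_prop) (by simp)
      (by simp) ?_
    rintro t ⟨h0, h1⟩
    have : v + (t : ℂ) • ((1 - cutoff v σ (-4)) * ((σ : ℂ) • 1 - v)) =
        cfc (fun z : ℂ => z + t • ((1 - cutoffFun σ (-4) z) * (σ - z))) v := by
      rw [cfc_add .., cfc_id' .., cfc_smul .., cfc_mul .., cfc_sub .., cfc_sub .., cfc_const_one ..,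
        cfc_id' .., cfc_const .., Algebra.algebraMap_eq_smul_one]
      simp [cutoff]
    rw [this, isUnit_cfc_iff ..]
    intro z hz h
    have hz1 : ‖z‖ = 1 := by
      have := Unitary.spectrum_subset_circle ⟨v, hv⟩ hz
      simpa using this
    set k : ℝ := max 0 (min 1 (-4 - 10 * (σ * z.re))) with hk'
    have hk0 : 0 ≤ k := le_max_left _ _
    have hk1 : k ≤ 1 := max_le zero_le_one (min_le_left _ _)
    have hc : cutoffFun σ (-4) z = k := rfl
    have hsq : z.re * z.re + z.im * z.im = 1 := by
      rw [← Complex.normSq_apply, Complex.normSq_eq_norm_sq, hz1, one_pow]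
    rw [hc] at h
    have hre : z.re + t * ((1 - k) * (σ - z.re)) = 0 := by simpa using congrArg Complex.re h
    have him : z.im + t * ((1 - k) * (-z.im)) = 0 := by
      simpa using congrArg Complex.im h
    have hσ2 : σ * σ = 1 := by rcases hσ with rfl | rfl <;> norm_num
    have hs0 : 0 ≤ t * (1 - k) := mul_nonneg h0 (by linarith)
    have hs1 : t * (1 - k) ≤ 1 := mul_le_one₀ h1 (by linarith) (by linarith)
    have hx : (1 - t * (1 - k)) * (σ * z.re) + t * (1 - k) = 0 := by
      linear_combination σ * hre - t * (1 - k) * hσ2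
    have hsne : t * (1 - k) ≠ 1 := fun hs => by rw [hs] at hx; norm_num at hx
    have him0 : z.im = 0 := by
      have : (1 - t * (1 - k)) * z.im = 0 := by linear_combination him
      exact (mul_eq_zero.1 this).resolve_left (sub_ne_zero.2 hsne.symm)
    have hre2 : (σ * z.re - 1) * (σ * z.re + 1) = 0 := by
      rw [him0] at hsq
      linear_combination σ * σ * hsq + hσ2
    rcases mul_eq_zero.1 hre2 with h2 | h2
    · rw [sub_eq_zero.1 h2] at hx
      norm_num at hx
    · have h3 : σ * z.re = -1 := by linarith
      have hk2 : k = 1 := by rw [hk', h3]; norm_num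
      rw [hk2, h3] at hx
      norm_num at hx
  · rw [hval, ← mul_assoc, ← (cutoff_commute ..).eq, hk]
  · rw [hval, mul_assoc, hcomm.eq, ← mul_assoc, hk]

end Cutoff

section Abelian

variable {R : Type*} [CStarAlgebra R]

lemma UnitJoined.one_sub_of_mul_self_eq_zero {n : R} (hn : n * n = 0) : UnitJoined (1 - n) 1 := by
  refine UnitJoined.of_continuous (fun t => 1 - (1 - t) • n) (by fun_prop) (by simp) (by simp) ?_
  intro t _
  refine ⟨⟨1 - (1 - t) • n, 1 + (1 - t) • n, ?_, ?_⟩, rfl⟩ <;>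
  · simp [sub_mul, mul_add, add_mul, mul_sub, hn]

/-- A unit close to an element `y` agreeing with `1` on the left of `e₃` is joined to a unitary
almost acting as the identity on `e₁`. -/
lemma eventually_joined_unitary {y e₁ e₂ e₃ : R} (he₁ : IsSelfAdjoint e₁) (h12 : e₁ * e₂ = e₁)
    (h21 : e₂ * e₁ = e₁) (h23 : e₂ * e₃ = e₂) (h32 : e₃ * e₂ = e₂) (hy : e₃ * y = e₃) {η : ℝ}
    (hη : 0 < η) :
    ∀ᶠ z in 𝓝 y, IsUnit z → ∃ W ∈ unitary R, UnitJoined z W ∧ ‖W * e₁ - e₁‖ < η ∧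
      ‖e₁ * W - e₁‖ < η := by
  let _ := CStarAlgebra.spectralOrder R
  have := CStarAlgebra.spectralOrderedRing R
  let z₁ (z : R) : R := (1 - (1 - e₃) * z * e₂) * z
  have h2y : e₂ * y = e₂ := by rw [← h23, mul_assoc, hy]
  have h1y : e₁ * y = e₁ := by rw [← h12, mul_assoc, h2y]
  have hzy : z₁ y = y - y * e₂ + e₂ := by
    calc z₁ y = y - (y * (e₂ * y) - e₃ * y * (e₂ * y)) := by simp only [z₁]; noncomm_ring
      _ = y - y * e₂ + e₂ := by rw [h2y, hy, h32]; abel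
  have hr : z₁ y * e₁ = e₁ := by
    rw [hzy, add_mul, sub_mul, mul_assoc, h21]; abel
  have hl : e₁ * z₁ y = e₁ := by
    rw [hzy, mul_add, mul_sub, ← mul_assoc, h1y, h12]; abel
  have hl' : star (z₁ y) * e₁ = e₁ := by
    have := congrArg star hl
    rwa [star_mul, he₁.star_eq] at this
  have hc : Continuous z₁ := by fun_prop
  have key (s : R → R) (hs : Continuous s) (h1 : s (z₁ y) * e₁ = e₁)
      (h2 : star (s (z₁ y)) * s (z₁ y) * e₁ = e₁) :
      ∀ᶠ z in 𝓝 y, ‖s (z₁ z) * e₁ - e₁‖ + ‖star (s (z₁ z)) * s (z₁ z) * e₁ - e₁‖ < η := by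
    have : Continuous fun z =>
        ‖s (z₁ z) * e₁ - e₁‖ + ‖star (s (z₁ z)) * s (z₁ z) * e₁ - e₁‖ := by fun_prop
    refine this.continuousAt.eventually (gt_mem_nhds ?_)
    simpa [h1, h2] using hη
  filter_upwards [key id continuous_id hr (by simp [mul_assoc, hr, hl'])] with z h1 hz
  have hn : (1 - e₃) * z * e₂ * ((1 - e₃) * z * e₂) = 0 := by
    have : e₂ * (1 - e₃) = 0 := by rw [mul_sub, mul_one, h23, sub_self]
    calc _ = (1 - e₃) * z * (e₂ * (1 - e₃)) * (z * e₂) := by noncomm_ring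
      _ = 0 := by rw [this]; simp
  have hj : UnitJoined (z₁ z) z := by
    simpa using (UnitJoined.one_sub_of_mul_self_eq_zero hn).mul (UnitJoined.refl hz)
  have hu := hj.isUnit_left
  have hW := unitaryPart_mem_unitary hu
  have hle := (norm_unitaryPart_mul_sub_le hu e₁).trans_lt h1
  refine ⟨_, hW, hj.symm.trans (.unitaryPart hu), hle, ?_⟩
  have h3 : ‖star (unitaryPart (z₁ z)) * e₁ - e₁‖ < η := by
    have := CStarRing.norm_coe_unitary_mul ⟨_, hW⟩
      (star (unitaryPart (z₁ z)) * e₁ - e₁)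
    rw [← this, mul_sub, ← mul_assoc, hW.2, one_mul, norm_sub_rev]
    exact hle
  rw [← norm_star, star_sub, star_mul, he₁.star_eq]
  exact h3

/-- A unitary almost acting as the identity on `e` commutes up to a path with each unit which is
scalar off `e`. -/
lemma exists_forall_commute_of_scalar_off {v e : R} (hv : IsUnit v) (σ : ℂ)
    (h1 : e * (v - σ • 1) = v - σ • 1) (h2 : (v - σ • 1) * e = v - σ • 1) :
    ∃ η > 0, ∀ W ∈ unitary R, ‖W * e - e‖ < η → ‖e * W - e‖ < η → UnitJoined (W * v) (v * W) := by
  obtain ⟨δ, hδ, h⟩ := Metric.eventually_nhds_iff.1 (unitsLocallyJoined_of_normedRing R v hv)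
  generalize hn : v - σ • 1 = n at h1 h2
  have hN : 0 < 2 * (‖n‖ + 1) := by positivity
  refine ⟨δ / (2 * (‖n‖ + 1)), by positivity, fun W hW hl hr => ?_⟩
  have hd : ‖W * v - v * W‖ < δ := by
    have : W * v - v * W = (W * e - e) * n - n * (e * W - e) := by
      have : v = n + σ • 1 := by simp [← hn]
      have h3 : (W * e - e) * n - n * (e * W - e) = W * n - n * W := by
        rw [sub_mul, mul_sub, mul_assoc W, h1, ← mul_assoc n, h2]; abel
      rw [h3, this]
      simp [mul_add, add_mul]
    rw [this]
    calc _ ≤ ‖W * e - e‖ * ‖n‖ + ‖n‖ * ‖e * W - e‖ :=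
          (norm_sub_le _ _).trans (add_le_add (norm_mul_le _ _) (norm_mul_le _ _))
      _ ≤ δ / (2 * (‖n‖ + 1)) * ‖n‖ + ‖n‖ * (δ / (2 * (‖n‖ + 1))) := by gcongr
      _ = δ * (‖n‖ / (‖n‖ + 1)) := by field_simp; ring
      _ < δ * 1 := by
          gcongr
          rw [div_lt_one (by positivity)]
          linarith
      _ = δ := mul_one δ
  have hj : UnitJoined v (W * v * star W) := by
    refine h ?_
    rw [dist_eq_norm, ← CStarRing.norm_mul_coe_unitary _ ⟨W, hW⟩, sub_mul]
    simpa [mul_assoc, hW.1] using hd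
  have hWu : IsUnit W := ⟨⟨W, star W, hW.2, hW.1⟩, rfl⟩
  have := hj.symm.mul (.refl hWu)
  rwa [mul_assoc, hW.1, mul_one] at this

lemma joined_commute_unitary (hd : UnitsDense R) {u v : R} (hu : IsUnit u) (hv : v ∈ unitary R) :
    UnitJoined (u * v) (v * u) := by
  have hn : IsStarNormal v := ⟨hv.1.trans hv.2.symm⟩
  obtain ⟨u, rfl⟩ := hu
  set e := cutoff v 1 1 with he
  set y := e + (1 - e) * (u : R) with hy
  have hchain (σ : ℝ) := cutoff_mul_cutoff_of_le v (σ := σ) (n := -3) (m := -2) (by norm_num)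
  have hchain' (σ : ℝ) := cutoff_mul_cutoff_of_le v (σ := σ) (n := -2) (m := -1) (by norm_num)
  have main {σ : ℝ} (hσ : σ = 1 ∨ σ = -1) {x : R} (hx : cutoff v σ (-1) * x = cutoff v σ (-1)) :
      ∀ᶠ z in 𝓝 x, IsUnit z → UnitJoined (z * v) (v * z) := by
    obtain ⟨v', hvv', h1, h2⟩ := exists_joined_eq_off_cutoff hv hσ
    obtain ⟨η, hη, H⟩ := exists_forall_commute_of_scalar_off hvv'.isUnit_right σ h1 h2
    have := eventually_joined_unitary (isSelfAdjoint_cutoff v σ (-3)) (hchain σ)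
      (by rw [(cutoff_commute ..).eq, hchain]) (hchain' σ)
      (by rw [(cutoff_commute ..).eq, hchain']) hx hη
    filter_upwards [this] with z hz hzu
    obtain ⟨W, hW, hzW, hl, hr⟩ := hz hzu
    exact UnitJoined.commute_of_joined hzW hvv' (H W hW hl hr)
  have hp : cutoff v 1 (-1) * e = cutoff v 1 (-1) := cutoff_mul_cutoff_of_le v (by norm_num)
  have hm : cutoff v (-1) (-1) * e = 0 := cutoff_mul_cutoff_eq_zero v (by norm_num)
  have h1 := main (.inl rfl) (x := y) (by
    rw [hy, mul_add, ← mul_assoc, mul_sub, hp]; simp)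
  have h2 := main (.inr rfl) (x := y * (↑u⁻¹ : R)) (by
    rw [hy, ← mul_assoc, mul_add, ← mul_assoc _ (1 - e), mul_sub, hm]; simp [mul_assoc])
  have hc : ContinuousAt (fun z => z * (↑u⁻¹ : R)) y := by fun_prop
  obtain ⟨z, hz, h3, h4⟩ :=
    ((mem_closure_iff_frequently.1 (hd y)).and_eventually (h1.and (hc.eventually h2))).exists
  obtain ⟨w, hw⟩ : IsUnit (z * (↑u⁻¹ : R)) := IsUnit.mul hz u⁻¹.isUnit
  have hzw : z = w * u := by rw [hw, mul_assoc, Units.inv_mul, mul_one]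
  replace h3 := h3 hz
  replace h4 := h4 (hw ▸ w.isUnit)
  rw [← hw] at h4
  rw [hzw] at h3
  have h5 := h3.trans (by simpa only [mul_assoc] using h4.symm.mul (.refl u.isUnit))
  simpa [mul_assoc] using (UnitJoined.refl w⁻¹.isUnit).mul h5

/-- In a `C⋆`-algebra with dense units, the group of path components of units is abelian. -/
lemma unitsCommuteUpToPath (hd : UnitsDense R) : UnitsCommuteUpToPath R := by
  let _ := CStarAlgebra.spectralOrder R
  have := CStarAlgebra.spectralOrderedRing R
  intro a b ha hb
  exact UnitJoined.commute_of_joined (.refl ha) (.unitaryPart hb)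
    (joined_commute_unitary hd ha (unitaryPart_mem_unitary hb))

end Abelian

section MatrixCStar

set_option linter.unusedSectionVars false

open Matrix

variable {A : Type*} [CStarAlgebra A] {T : Type*} [Fintype T] [DecidableEq T]

lemma unitsLocallyJoined_matrix : UnitsLocallyJoined (Matrix T T A) := by
  let _ := CStarAlgebra.spectralOrder A
  have := CStarAlgebra.spectralOrderedRing A
  exact unitsLocallyJoined_of_normedRing (CStarMatrix T T A)

lemma continuousAt_inverse_matrix {g : Matrix T T A} (hg : IsUnit g) :
    ContinuousAt Ring.inverse g := by
  let _ := CStarAlgebra.spectralOrder A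
  have := CStarAlgebra.spectralOrderedRing A
  obtain ⟨u, rfl⟩ := hg
  exact NormedRing.inverse_continuousAt (R := CStarMatrix T T A) u

lemma unitsCommuteUpToPath_matrix (h : UnitsDense (Matrix T T A)) :
    UnitsCommuteUpToPath (Matrix T T A) := by
  let _ := CStarAlgebra.spectralOrder A
  have := CStarAlgebra.spectralOrderedRing A
  exact unitsCommuteUpToPath (R := CStarMatrix T T A) h

lemma UnitJoined.reindex {S : Type*} [Fintype S] [DecidableEq S] (e : T ≃ S) {x y : Matrix T T A}
    (h : UnitJoined x y) : UnitJoined (Matrix.reindex e e x) (Matrix.reindex e e y) :=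
  h.map (Matrix.reindex e e) (continuous_id.matrix_reindex e e)
    fun _ hx => hx.map (Matrix.reindexRingEquiv A e)

lemma UnitsDense.reindex {S : Type*} [Fintype S] [DecidableEq S] (e : T ≃ S)
    (h : UnitsDense (Matrix T T A)) : UnitsDense (Matrix S S A) := by
  intro g
  have := map_mem_closure (continuous_id.matrix_reindex e e)
    (h (Matrix.reindex e.symm e.symm g)) (t := {x | IsUnit x})
    (fun x hx => IsUnit.map (Matrix.reindexRingEquiv A e) hx)
  simpa using this

lemma Matrix.reindex_diagonal_update {S : Type*} [DecidableEq S] (e : T ≃ S) (t : T) (u : A) :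
    Matrix.reindex e e (diagonal (Function.update 1 t u)) =
      diagonal (Function.update 1 (e t) u) := by
  rw [reindex_apply, submatrix_diagonal_equiv]
  congr 1
  ext i
  simp [Function.update_apply, Equiv.symm_apply_eq]

lemma unitsDense_matrix_of_card_eq_two_pow (hA : UnitsDense A) (m : ℕ) :
    ∀ (T : Type) [Fintype T] [DecidableEq T], Fintype.card T = 2 ^ m →
      UnitsDense (Matrix T T A) := by
  induction m with
  | zero =>
    intro T _ _ hT
    obtain ⟨t, ht⟩ := Fintype.card_eq_one_iff.1 (by simpa using hT)
    intro g
    have hg : g = diagonal (fun _ => g t t) := by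
      ext i j; rw [ht i, ht j]; simp
    rw [hg]
    have hc : Continuous fun x : A => (diagonal (fun _ => x) : Matrix T T A) := by fun_prop
    refine map_mem_closure (f := fun x : A => (diagonal (fun _ => x) : Matrix T T A)) hc (hA (g t t)) fun x hx => ?_
    obtain ⟨x, rfl⟩ := hx
    exact ⟨⟨diagonal fun _ => (x : A), diagonal fun _ => (↑x⁻¹ : A), by simp, by simp⟩, rfl⟩
  | succ m ih =>
    intro T _ _ hT
    have e : Fin (2 ^ m) ⊕ Fin (2 ^ m) ≃ T := Fintype.equivOfCardEq (by simp [hT, pow_succ]; ring)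
    exact (unitsDense_fromBlocks (ih (Fin (2 ^ m)) (by simp))).reindex e

lemma UnitJoined.of_diagonal_of_card_eq_two_pow (hA : UnitsDense A) {u : A} (m : ℕ) :
    ∀ (T : Type) [Fintype T] [DecidableEq T] (t : T), Fintype.card T = 2 ^ m →
      UnitJoined (diagonal (Function.update 1 t u) : Matrix T T A) 1 → UnitJoined u 1 := by
  induction m with
  | zero =>
    intro T _ _ t hT h
    have ht : ∀ s, s = t := fun s =>
      Fintype.card_le_one_iff.1 (by simpa using hT.le) s t
    have := h.map (fun x => x t t) (by fun_prop) (by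
      rintro _ ⟨x, rfl⟩
      have h1 := congrFun₂ x.mul_inv t t
      have h2 := congrFun₂ x.inv_mul t t
      have : (Finset.univ : Finset T) = {t} := by
        ext s; simp [ht s]
      rw [mul_apply, this, Finset.sum_singleton] at h1 h2
      exact ⟨⟨_, (↑x⁻¹ : Matrix T T A) t t, by simpa using h1, by simpa using h2⟩, rfl⟩)
    simpa using this
  | succ m ih =>
    intro T _ _ t hT h
    have e₀ : T ≃ Fin (2 ^ m) ⊕ Fin (2 ^ m) := Fintype.equivOfCardEq (by simp [hT, pow_succ]; ring)
    let s : Fin (2 ^ m) := ⟨0, by positivity⟩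
    let e := e₀.trans (Equiv.swap (e₀ t) (Sum.inl s))
    have he : e t = Sum.inl s := by simp [e]
    have h1 := h.reindex e
    rw [reindex_diagonal_update, he] at h1
    have h2 : (diagonal (Function.update 1 (Sum.inl s) u) : Matrix (Fin (2 ^ m) ⊕ Fin (2 ^ m)) _ A) =
        fromBlocks (diagonal (Function.update 1 s u)) 0 0 1 := by
      rw [← diagonal_one, fromBlocks_diagonal]
      congr 1
      ext (i | i) <;> simp [Function.update_apply]
    rw [h2] at h1
    have hd := unitsDense_matrix_of_card_eq_two_pow hA m (Fin (2 ^ m)) (by simp)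
    refine ih (Fin (2 ^ m)) s (by simp) (UnitJoined.of_fromBlocks hd unitsLocallyJoined_matrix
      (unitsCommuteUpToPath_matrix hd) (continuousAt_inverse_matrix isUnit_one)
      (fun g hg => continuousAt_inverse_matrix hg) unitsLocallyJoined_matrix (by simpa using h1))

/-- In stable rank one, the map from the components of units to those of matrices is injective. -/
lemma UnitJoined.of_fromBlocks_one (hA : UnitsDense A) {u : A} {k : ℕ}
    (h : UnitJoined (fromBlocks (diagonal fun _ => u) 0 0 1 :
      Matrix (Fin 1 ⊕ Fin k) (Fin 1 ⊕ Fin k) A) 1) : UnitJoined u 1 := by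
  have hk : 1 + k ≤ 2 ^ (1 + k) := Nat.lt_two_pow_self.le
  refine UnitJoined.of_diagonal_of_card_eq_two_pow hA (1 + k)
    ((Fin 1 ⊕ Fin k) ⊕ Fin (2 ^ (1 + k) - (1 + k))) (.inl (.inl 0)) (by simp; omega) ?_
  have := h.map (fun x => (fromBlocks x 0 0 1 :
    Matrix ((Fin 1 ⊕ Fin k) ⊕ Fin (2 ^ (1 + k) - (1 + k))) _ A))
    (continuous_id.matrix_fromBlocks continuous_const continuous_const continuous_const)
    (fun x hx => isUnit_fromBlocks_diagonal.2 ⟨hx, isUnit_one⟩)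
  simp only [fromBlocks_one] at this
  convert this using 1
  rw [← diagonal_one, fromBlocks_diagonal, ← diagonal_one, fromBlocks_diagonal]
  congr 1
  ext ((i | i) | i)
  · simp [Subsingleton.elim i 0]
  all_goals simp

end MatrixCStar

section Hereditary

variable {A : Type*} [CStarAlgebra A]

lemma norm_ofReal_smul_one_le {s : ℝ} (hs : 0 ≤ s) : ‖((s : ℂ) • 1 : A)‖ ≤ s := by
  rcases subsingleton_or_nontrivial A with h | h
  · rw [Subsingleton.elim ((s : ℂ) • 1 : A) 0, norm_zero]; exact hs
  · simp [norm_smul, abs_of_nonneg hs]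

lemma norm_sub_compress_le {e a : A} (he : ‖e‖ ≤ 1) {s : ℝ}
    (hl : ‖(1 - e) * (a - 1)‖ ≤ s) (hr : ‖(a - 1) * (1 - e)‖ ≤ s) :
    ‖a - (1 + e * (a - 1) * e)‖ ≤ 2 * s := by
  have : a - (1 + e * (a - 1) * e) = (1 - e) * (a - 1) + e * ((a - 1) * (1 - e)) := by
    noncomm_ring
  rw [this, two_mul]
  refine (norm_add_le _ _).trans (add_le_add hl ?_)
  exact (norm_mul_le _ _).trans ((mul_le_of_le_one_left (norm_nonneg _) he).trans hr)

lemma isUnit_of_norm_unitary_sub_lt {W x : A} (hW : W ∈ unitary A) (h : ‖W - x‖ < 1) :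
    IsUnit x := by
  have h1 : x = W * (1 - star W * (W - x)) := by
    rw [mul_sub, ← mul_assoc, hW.2]; simp
  rw [h1]
  refine IsUnit.mul ⟨⟨W, star W, hW.2, hW.1⟩, rfl⟩ (isUnit_one_sub_of_norm_lt_one ?_)
  have := CStarRing.norm_coe_unitary_mul ⟨_, (Unitary.star_mem hW)⟩ (W - x)
  exact this.trans_lt h

lemma norm_star_sub_one_mul {W f : A} (hW : W ∈ unitary A) (hf : IsSelfAdjoint f) :
    ‖f * (W - 1)‖ = ‖(W - 1) * f‖ := by
  rw [← norm_star, star_mul, hf.star_eq, ← CStarRing.norm_coe_unitary_mul ⟨_, hW⟩, ← norm_neg]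
  congr 1
  simp only [star_sub, star_one, sub_mul, mul_sub, ← mul_assoc, hW.2]
  simp

lemma exists_unit_compress_near {e z : A} (he : IsSelfAdjoint e) (he1 : ‖e‖ ≤ 1) (hz : IsUnit z)
    {s : ℝ} (hs0 : 0 < s) (hs1 : s ≤ 1 / 4)
    (h : ‖z * (1 - e) - (1 - e)‖ + ‖star z * z * (1 - e) - (1 - e)‖ ≤ s) :
    ∃ a b : A, IsUnit ((1 + e * a * e) * ((1 + s : ℂ) • 1 + e * b * e)) ∧
      ‖(1 + e * a * e) * ((1 + s : ℂ) • 1 + e * b * e) - z‖ ≤ 5 * s * (‖z‖ + 1) := by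
  let _ := CStarAlgebra.spectralOrder A
  have := CStarAlgebra.spectralOrderedRing A
  have hf : IsSelfAdjoint (1 - e) := (IsSelfAdjoint.one A).sub he
  have hW := unitaryPart_mem_unitary hz
  have h1 : ‖(unitaryPart z - 1) * (1 - e)‖ ≤ s := by
    rw [sub_mul, one_mul]; exact (norm_unitaryPart_mul_sub_le hz _).trans h
  have h2 : ‖(CFC.abs z - 1) * (1 - e)‖ ≤ s := by
    refine (norm_sub_one_mul_le (CFC.abs_nonneg z) _).trans ?_
    rw [CFC.abs_mul_abs, sub_mul (star z * z), one_mul]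
    exact le_trans (by linarith [norm_nonneg (z * (1 - e) - (1 - e))]) h
  have h2' : ‖(1 - e) * (CFC.abs z - 1)‖ ≤ s := by
    rw [← norm_star, star_mul, hf.star_eq, star_sub, (CFC.abs_nonneg z).isSelfAdjoint.star_eq,
      star_one]
    exact h2
  have hWn := norm_sub_compress_le he1 ((norm_star_sub_one_mul hW hf).le.trans h1) h1
  have hhn := norm_sub_compress_le he1 h2' h2
  set W' := 1 + e * (unitaryPart z - 1) * e with hW'
  set h' := 1 + e * (CFC.abs z - 1) * e with hh'
  have hsum : (1 + s : ℂ) • 1 + e * (CFC.abs z - 1) * e = h' + (s : ℂ) • 1 := by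
    rw [hh', add_smul, one_smul]; abel
  refine ⟨unitaryPart z - 1, CFC.abs z - 1, ?_, ?_⟩ <;> rw [hsum, ← hW']
  · refine IsUnit.mul (isUnit_of_norm_unitary_sub_lt hW (by linarith)) ?_
    have hpos : 0 ≤ h' := by
      have h3 : e * e ≤ 1 := by
        have := CStarAlgebra.star_mul_le_algebraMap_norm_sq (a := e)
        rw [he.star_eq] at this
        refine this.trans ?_
        rw [← map_one (algebraMap ℝ A)]
        exact algebraMap_mono A (pow_le_one₀ (norm_nonneg _) he1)
      have h4 : 0 ≤ e * CFC.abs z * e := he.conjugate_nonneg (CFC.abs_nonneg z)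
      have : h' = (1 - e * e) + e * CFC.abs z * e := by rw [hh']; noncomm_ring
      rw [this]
      exact add_nonneg (sub_nonneg.2 h3) h4
    have : IsStrictlyPositive ((s : ℂ) • 1 : A) := by
      have h5 : IsStrictlyPositive (s • 1 : A) := IsStrictlyPositive.smul hs0 (isUnit_one.isStrictlyPositive zero_le_one)
      simpa using h5
    rw [add_comm]
    exact (this.add_nonneg hpos).isUnit
  · have hhz : ‖h' + (s : ℂ) • 1 - CFC.abs z‖ ≤ 3 * s := by
      have : h' + (s : ℂ) • 1 - CFC.abs z = (s : ℂ) • 1 - (CFC.abs z - h') := by abel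
      rw [this]
      have h6 : ‖((s : ℂ) • 1 : A)‖ ≤ s :=
        norm_ofReal_smul_one_le hs0.le
      linarith [norm_sub_le ((s : ℂ) • 1 : A) (CFC.abs z - h')]
    have hhM : ‖h' + (s : ℂ) • 1‖ ≤ ‖z‖ + 1 := by
      have : h' + (s : ℂ) • 1 = CFC.abs z + (h' + (s : ℂ) • 1 - CFC.abs z) := by abel
      rw [this]
      refine (norm_add_le _ _).trans ?_
      rw [CFC.norm_abs]
      linarith
    have hd : W' * (h' + (s : ℂ) • 1) - z = (W' - unitaryPart z) * (h' + (s : ℂ) • 1) +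
        unitaryPart z * (h' + (s : ℂ) • 1 - CFC.abs z) := by
      rw [mul_sub, unitaryPart_mul_abs hz, sub_mul]; abel
    rw [norm_sub_rev] at hWn
    have hu := CStarRing.norm_coe_unitary_mul ⟨_, hW⟩ (h' + (s : ℂ) • 1 - CFC.abs z)
    simp only at hu
    calc _ ≤ ‖W' - unitaryPart z‖ * ‖h' + (s : ℂ) • 1‖ +
          ‖unitaryPart z * (h' + (s : ℂ) • 1 - CFC.abs z)‖ := by
            rw [hd]; exact (norm_add_le _ _).trans (by gcongr; exact norm_mul_le _ _)
      _ ≤ 2 * s * (‖z‖ + 1) + 3 * s := by rw [hu]; gcongr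
      _ ≤ 5 * s * (‖z‖ + 1) := by nlinarith [norm_nonneg z]

variable {B : NonUnitalStarSubalgebra ℂ A}

lemma exists_unit_near_one_add [IsClosed (B : Set A)]
    (hB : ∀ b ∈ B, ∀ a : A, ∀ b' ∈ B, b * a * b' ∈ B)
    (hA : UnitsDense A) {x : A} (hx : x ∈ B) {ε : ℝ} (hε : 0 < ε) :
    ∃ s : ℝ, 0 < s ∧ s < ε ∧ ∃ b ∈ B, IsUnit ((1 + s : ℂ) • 1 + b) ∧ ‖b - x‖ < ε := by
  let _ := CStarAlgebra.spectralOrder B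
  have := CStarAlgebra.spectralOrderedRing B
  set M := ‖1 + x‖ + 1 with hM
  have hM0 : 0 < M := by positivity
  obtain ⟨s, hs0, hs1, hs2, hs3⟩ : ∃ s : ℝ, 0 < s ∧ s ≤ 1 / 4 ∧ s < ε ∧
      5 * s * (M + 1) + s < ε / 2 := by
    have hD : 0 < 5 * (M + 1) + 1 := by positivity
    have hq : 0 < ε / (4 * (5 * (M + 1) + 1)) := by positivity
    have hm := min_le_right (1 / 4) (ε / (4 * (5 * (M + 1) + 1)))
    refine ⟨min (1 / 4) (ε / (4 * (5 * (M + 1) + 1))), by positivity, min_le_left _ _, ?_, ?_⟩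
    · refine hm.trans_lt (div_lt_self hε ?_)
      linarith
    · rw [le_div_iff₀ (by positivity)] at hm
      linarith
  have key : ∃ e ∈ B, IsSelfAdjoint e ∧ ‖e‖ ≤ 1 ∧
      ‖x * (1 - e)‖ + ‖(x + star x + star x * x) * (1 - e)‖ < s := by
    have hap := CStarAlgebra.increasingApproximateUnit B
    have h1 (y : B) : Tendsto (fun e : B => ‖(y : A) * (1 - (e : A))‖)
        (CStarAlgebra.approximateUnit B) (𝓝 0) := by
      have := ((hap.tendsto_mul_left y).const_sub y).norm
      rw [sub_self, norm_zero] at this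
      refine this.congr fun e => ?_
      rw [mul_sub, mul_one]; rfl
    have h2 := (h1 ⟨x, hx⟩).add (h1 ⟨x + star x + star x * x,
      add_mem (add_mem hx (star_mem hx)) (mul_mem (star_mem hx) hx)⟩)
    rw [add_zero] at h2
    have := hap.neBot
    obtain ⟨e, he1, he2, he3⟩ := ((h2.eventually (gt_mem_nhds hs0)).and
      (hap.eventually_nonneg.and hap.eventually_norm)).exists
    exact ⟨e, e.2, congrArg Subtype.val he2.isSelfAdjoint.star_eq, he3, he1⟩
  obtain ⟨e, heB, he, he1, hes⟩ := key
  have hc : Continuous fun z : A =>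
      ‖z * (1 - e) - (1 - e)‖ + ‖star z * z * (1 - e) - (1 - e)‖ := by fun_prop
  have h1 : ‖(1 + x) * (1 - e) - (1 - e)‖ +
      ‖star (1 + x) * (1 + x) * (1 - e) - (1 - e)‖ < s := by
    convert hes using 3
    · noncomm_ring
    · rw [star_add, star_one]; noncomm_ring
  have h2 := hc.continuousAt.eventually (gt_mem_nhds h1)
  have h3 := Metric.ball_mem_nhds (1 + x) (ε := min 1 (ε / 2)) (by positivity)
  obtain ⟨z, hz, hz1, hz2⟩ :=
    ((mem_closure_iff_frequently.1 (hA (1 + x))).and_eventually (h2.and h3)).exists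
  rw [dist_eq_norm, lt_min_iff] at hz2
  obtain ⟨a, b, hu, hn⟩ := exists_unit_compress_near he he1 hz hs0 hs1 hz1.le
  have hform : (1 + e * a * e) * ((1 + s : ℂ) • 1 + e * b * e) = (1 + s : ℂ) • 1 +
      (e * b * e + (1 + s : ℂ) • (e * a * e) + e * a * e * (e * b * e)) := by
    simp only [add_mul, mul_add, one_mul, mul_smul_comm, mul_one, smul_add]; abel
  refine ⟨s, hs0, hs2, _, ?_, hform ▸ hu, ?_⟩
  · have ha := hB e heB a e heB
    have hb := hB e heB b e heB
    exact add_mem (add_mem hb (SMulMemClass.smul_mem _ ha)) (mul_mem ha hb)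
  · generalize e * b * e + (1 + s : ℂ) • (e * a * e) + e * a * e * (e * b * e) = c at hform
    rw [hform] at hn
    have hzM : ‖z‖ ≤ M := by
      have := norm_sub_norm_le z (1 + x)
      linarith
    have h7 : ‖((s : ℂ) • 1 : A)‖ ≤ s :=
      norm_ofReal_smul_one_le hs0.le
    have h8 : c - x = ((1 + s : ℂ) • 1 + c - z) + (z - (1 + x)) - (s : ℂ) • 1 := by
      rw [add_smul, one_smul]; abel
    rw [h8]
    calc _ ≤ ‖(1 + s : ℂ) • 1 + c - z‖ + ‖z - (1 + x)‖ + ‖((s : ℂ) • 1 : A)‖ :=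
          (norm_sub_le _ _).trans (by gcongr; exact norm_add_le _ _)
      _ ≤ 5 * s * (‖z‖ + 1) + ε / 2 + s := by gcongr; exact hz2.2.le
      _ ≤ 5 * s * (M + 1) + ε / 2 + s := by gcongr
      _ < ε := by linarith

lemma isUnit_unitization_of_isUnit (hB : ∀ b ∈ B, ∀ a : A, ∀ b' ∈ B, b * a * b' ∈ B) {r : ℂ}
    (hr : r ≠ 0) {b : B} (h : IsUnit (r • 1 + (b : A))) :
    IsUnit (Unitization.inl r + Unitization.inr b : Unitization ℂ B) := by
  obtain ⟨u, hu⟩ := h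
  set y : A := (↑u⁻¹ : A)
  have h1 : (r • 1 + (b : A)) * y = 1 := by rw [← hu]; exact u.mul_inv
  have h2 : y * (r • 1 + (b : A)) = 1 := by rw [← hu]; exact u.inv_mul
  rw [add_mul, smul_mul_assoc, one_mul] at h1
  rw [mul_add, mul_smul_comm, mul_one] at h2
  have e1 : y = r⁻¹ • 1 - r⁻¹ • (b * y) := by
    rw [← smul_sub, ← h1, add_sub_cancel_right, smul_smul, inv_mul_cancel₀ hr, one_smul]
  have e2 : y = r⁻¹ • 1 - r⁻¹ • (y * b) := by
    rw [← smul_sub, ← h2, add_sub_cancel_right, smul_smul, inv_mul_cancel₀ hr, one_smul]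
  have hmem : y - r⁻¹ • 1 ∈ B := by
    have : y - r⁻¹ • 1 = (r⁻¹ * r⁻¹) • ((b : A) * y * b) - (r⁻¹ * r⁻¹) • (b : A) := by
      nth_rw 1 [e1]
      nth_rw 1 [e2]
      simp only [mul_sub, mul_smul_comm, mul_one, smul_sub, smul_smul, mul_assoc]
      abel
    rw [this]
    exact sub_mem (SMulMemClass.smul_mem _ (hB b b.2 y b b.2)) (SMulMemClass.smul_mem _ b.2)
  refine ⟨⟨_, Unitization.inl r⁻¹ + Unitization.inr (⟨_, hmem⟩ : B), ?_, ?_⟩, rfl⟩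
  · refine Unitization.ext ?_ (Subtype.ext ?_)
    · simp [hr]
    · have h3 : r • (y - r⁻¹ • 1) + r⁻¹ • (b : A) + b * (y - r⁻¹ • 1) = 0 := by
        rw [mul_sub, smul_sub, smul_smul, mul_inv_cancel₀ hr, one_smul, mul_smul_comm, mul_one,
          ← sub_eq_zero.2 h1]
        abel
      simpa using h3
  · refine Unitization.ext ?_ (Subtype.ext ?_)
    · simp [hr]
    · have h3 : r⁻¹ • (b : A) + (r • y - 1) + (y - r⁻¹ • 1) * b = 0 := by
        rw [sub_mul, smul_mul_assoc, one_mul, ← sub_eq_zero.2 h2]; abel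
      simpa [smul_sub, smul_smul, hr] using h3

variable [IsClosed (B : Set A)]

lemma UnitsDense.unitization (hB : ∀ b ∈ B, ∀ a : A, ∀ b' ∈ B, b * a * b' ∈ B)
    (hA : UnitsDense A) : UnitsDense (Unitization ℂ B) := by
  have hinl : Continuous (Unitization.inl : ℂ → Unitization ℂ B) :=
    continuous_algebraMap ℂ (Unitization ℂ B)
  have h1 (z : Unitization ℂ B) (hz : z.fst ≠ 0) :
      z ∈ closure {x : Unitization ℂ B | IsUnit x} := by
    have hx (n : ℕ) := exists_unit_near_one_add hB hA (z.fst⁻¹ • z.snd).2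
      (Nat.one_div_pos_of_nat (α := ℝ) (n := n))
    choose s hs0 hs b hb hu hbn using hx
    have hlim := tendsto_one_div_add_atTop_nhds_zero_nat (𝕜 := ℝ)
    have ls : Tendsto s atTop (𝓝 0) := squeeze_zero (fun n => (hs0 n).le) (fun n => (hs n).le) hlim
    have lb : Tendsto (fun n => (⟨b n, hb n⟩ : B)) atTop (𝓝 (z.fst⁻¹ • z.snd)) := by
      rw [tendsto_iff_norm_sub_tendsto_zero]
      exact squeeze_zero (fun n => norm_nonneg _) (fun n => (hbn n).le) hlim
    have l1 : Tendsto (fun n => (1 + s n : ℂ)) atTop (𝓝 1) := by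
      simpa using ((Complex.continuous_ofReal.tendsto 0).comp ls).const_add 1
    have l2 := (((hinl.tendsto 1).comp l1).add
      ((Unitization.continuous_inr.tendsto _).comp lb)).const_smul z.fst
    have : z.fst • (Unitization.inl 1 + Unitization.inr (z.fst⁻¹ • z.snd)) = z := by
      refine Unitization.ext ?_ ?_ <;> simp [hz]
    rw [this] at l2
    refine mem_closure_of_tendsto l2 (Eventually.of_forall fun n => ?_)
    have hne : (1 + s n : ℂ) ≠ 0 := by
      exact_mod_cast (by linarith [hs0 n] : (1 + s n : ℝ) ≠ 0)
    have := isUnit_unitization_of_isUnit hB hne (b := ⟨b n, hb n⟩) (hu n)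
    exact this.smul (Units.mk0 _ hz)
  refine dense_closure.1 (Dense.mono h1 fun z => ?_)
  have hc : Continuous fun t : ℂ => z + Unitization.inl t := by fun_prop
  have hd : Dense {t : ℂ | t ≠ -z.fst} := dense_compl_singleton _
  have := map_mem_closure hc (hd 0) (t := {z : Unitization ℂ B | z.fst ≠ 0})
    fun t (ht : t ≠ -z.fst) h0 => ht (eq_neg_of_add_eq_zero_right (by simpa using h0))
  rwa [Unitization.inl_zero, add_zero] at this

lemma K1Trivial.unitJoined_one {B : Type*} [NonUnitalCStarAlgebra B] (hK : K1Trivial B)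
    (hd : UnitsDense (Unitization ℂ B)) {x : Unitization ℂ B} (hx : IsUnit x) : UnitJoined x 1 := by
  let _ := CStarAlgebra.spectralOrder (Unitization ℂ B)
  have := CStarAlgebra.spectralOrderedRing (Unitization ℂ B)
  refine (UnitJoined.unitaryPart hx).trans ?_
  have hu := unitaryPart_mem_unitary hx
  generalize unitaryPart x = u at hu
  have hU : (Matrix.diagonal fun _ => u : Matrix (Fin 1) (Fin 1) (Unitization ℂ B)) ∈
      unitary (Matrix (Fin 1) (Fin 1) (Unitization ℂ B)) := by
    rw [Unitary.mem_iff, Matrix.star_eq_conjTranspose, Matrix.diagonal_conjTranspose]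
    simp [Matrix.diagonal_mul_diagonal, hu.1, hu.2, Pi.star_def]
  obtain ⟨k, h, hj⟩ := hK 1 one_pos ⟨_, hU⟩
  refine UnitJoined.of_fromBlocks_one hd (k := k) ?_
  obtain ⟨γ⟩ := hj
  refine UnitJoined.symm ⟨γ.map continuous_subtype_val, fun t => ?_⟩
  exact ⟨⟨_, _, (γ t).2.2, (γ t).2.1⟩, rfl⟩

lemma UnitsDense.of_stableRankOne (h : StableRankOne A) : UnitsDense A := by
  let f : Unitization ℂ A →ₐ[ℂ] A := Unitization.lift (NonUnitalAlgHom.id ℂ A)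
  have hf (x : Unitization ℂ A) : f x = algebraMap ℂ A x.fst + x.snd := rfl
  have hc : Continuous f := by
    change Continuous fun x => f x
    simp only [hf]
    exact ((continuous_algebraMap ℂ A).comp Unitization.continuous_fst).add
      Unitization.continuous_snd
  intro a
  have := map_mem_closure hc (h (Unitization.inr a)) (t := {x : A | IsUnit x})
    fun x hx => hx.map f
  simpa [hf] using this

end Hereditary

section Paths

variable {A : Type*} [CStarAlgebra A]

lemma joinedIn_isUnit_one_add {B : NonUnitalStarSubalgebra ℂ A} [IsClosed (B : Set A)]
    (hB : ∀ b ∈ B, ∀ a : A, ∀ b' ∈ B, b * a * b' ∈ B) (hA : UnitsDense A) (hK : K1Trivial B)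
    {w : A} (hw : IsUnit w) (hwB : w - 1 ∈ B) :
    JoinedIn {c : A | IsUnit c ∧ c - 1 ∈ B} 1 w := by
  have hx : IsUnit (Unitization.inl 1 + Unitization.inr (⟨w - 1, hwB⟩ : B) : Unitization ℂ B) :=
    isUnit_unitization_of_isUnit hB one_ne_zero (by simpa using hw)
  have hj := (hK.unitJoined_one (hA.unitization hB) hx).symm
  have hfst {z : Unitization ℂ B} (hz : IsUnit z) : z.fst ≠ 0 :=
    (hz.map (Unitization.fstHom ℂ B)).ne_zero
  let f : Unitization ℂ B →ₐ[ℂ] A := Unitization.lift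
    (NonUnitalStarAlgHom.toNonUnitalAlgHom (NonUnitalStarSubalgebraClass.subtype B))
  have hf (z : Unitization ℂ B) : f z = algebraMap ℂ A z.fst + z.snd := rfl
  have hc : ContinuousOn (fun z : Unitization ℂ B => z.fst⁻¹ • f z) {z | IsUnit z} := by
    simp only [hf]
    refine ContinuousOn.smul (Unitization.continuous_fst.continuousOn.inv₀ fun z hz => hfst hz) ?_
    exact (((continuous_algebraMap ℂ A).comp Unitization.continuous_fst).add
      (continuous_subtype_val.comp Unitization.continuous_snd)).continuousOn
  have := (JoinedIn.map_continuousOn hj hc).mono (V := {c : A | IsUnit c ∧ c - 1 ∈ B}) ?_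
  · simpa [hf] using this
  · rintro _ ⟨z, hz, rfl⟩
    refine ⟨(hz.map f).smul (Units.mk0 _ (inv_ne_zero (hfst hz))), ?_⟩
    have : z.fst⁻¹ • f z - 1 = z.fst⁻¹ • (z.snd : A) := by
      rw [hf, smul_add, Algebra.algebraMap_eq_smul_one, smul_smul, inv_mul_cancel₀ (hfst hz)]
      simp
    simp only [this]
    exact SMulMemClass.smul_mem _ z.snd.2

/-- The hereditary subalgebra of elements on which `k` acts as a two-sided unit. -/
def localUnitSubalgebra {k : A} (hk : IsSelfAdjoint k) : NonUnitalStarSubalgebra ℂ A where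
  carrier := {x | k * x = x ∧ x * k = x}
  add_mem' := fun hx hy => ⟨by rw [mul_add, hx.1, hy.1], by rw [add_mul, hx.2, hy.2]⟩
  zero_mem' := ⟨mul_zero _, zero_mul _⟩
  mul_mem' := fun hx hy => ⟨by rw [← mul_assoc, hx.1], by rw [mul_assoc, hy.2]⟩
  smul_mem' := fun c x hx => ⟨by rw [mul_smul_comm, hx.1], by rw [smul_mul_assoc, hx.2]⟩
  star_mem' := fun {x} hx => by
    refine ⟨?_, ?_⟩
    · rw [← hk.star_eq, ← star_mul, hx.2]
    · rw [← hk.star_eq, ← star_mul, hx.1]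

lemma isClosed_localUnitSubalgebra {k : A} (hk : IsSelfAdjoint k) :
    IsClosed (localUnitSubalgebra hk : Set A) :=
  (isClosed_eq (by fun_prop) (by fun_prop)).inter (isClosed_eq (by fun_prop) (by fun_prop))

lemma mul_mem_localUnitSubalgebra {k : A} (hk : IsSelfAdjoint k) :
    ∀ b ∈ localUnitSubalgebra hk, ∀ a : A, ∀ b' ∈ localUnitSubalgebra hk,
      b * a * b' ∈ localUnitSubalgebra hk :=
  fun b hb a b' hb' => ⟨by rw [← mul_assoc, ← mul_assoc, hb.1], by rw [mul_assoc, hb'.2]⟩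

/-- The image of a segment under an affine map of the form `x ↦ l * x * r` joins the images of its
endpoints, within the units close to `a`. -/
lemma joinedIn_of_segment {a l r x y : A} {ε : ℝ} (hl : IsUnit l) (hr : IsUnit r)
    (hu : ∀ z ∈ segment ℝ x y, IsUnit z) (hx : ‖l * x * r - a‖ < ε) (hy : ‖l * y * r - a‖ < ε) :
    JoinedIn {c : A | IsUnit c ∧ ‖c - a‖ < ε} (l * x * r) (l * y * r) := by
  refine JoinedIn.of_segment_subset fun c hc => ⟨?_, ?_⟩
  · obtain ⟨s, t, hs, ht, hst, rfl⟩ := hc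
    have : s • (l * x * r) + t • (l * y * r) = l * (s • x + t • y) * r := by
      simp only [mul_add, add_mul, mul_smul_comm, smul_mul_assoc]
    rw [this]
    exact (hl.mul (hu _ ⟨s, t, hs, ht, hst, rfl⟩)).mul hr
  · rw [← mem_ball_iff_norm] at hx hy ⊢
    exact (convex_ball a ε).segment_subset hx hy hc

lemma isUnit_of_mem_segment_of_unitary {w w' x : A} (hw : w ∈ unitary A) (h : ‖w - w'‖ < 1)
    (hx : x ∈ segment ℝ w w') : IsUnit x := by
  refine isUnit_of_norm_unitary_sub_lt hw ?_
  have h1 : w' ∈ Metric.ball w 1 := by rwa [mem_ball_iff_norm']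
  have := (convex_ball w 1).segment_subset (Metric.mem_ball_self one_pos) h1 hx
  rwa [mem_ball_iff_norm'] at this

variable [PartialOrder A] [StarOrderedRing A]

lemma NoK1Obstructions.joinedIn_unitary (hA : NoK1Obstructions A) {k w : A} (hk : IsSelfAdjoint k)
    (hw : IsUnit w) (hl : k * (w - 1) = w - 1) (hr : (w - 1) * k = w - 1) :
    JoinedIn {W : A | W ∈ unitary A ∧ (W - 1) * (1 - k) = 0} 1 (unitaryPart w) := by
  have := isClosed_localUnitSubalgebra hk
  have hj := joinedIn_isUnit_one_add (mul_mem_localUnitSubalgebra hk)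
    (UnitsDense.of_stableRankOne hA.1) (hA.2 _ (mul_mem_localUnitSubalgebra hk)) hw ⟨hl, hr⟩
  have := (JoinedIn.map_continuousOn hj (f := unitaryPart) fun c hc =>
    (continuousAt_unitaryPart hc.1).continuousWithinAt).mono
    (V := {W : A | W ∈ unitary A ∧ (W - 1) * (1 - k) = 0}) ?_
  · have h1 : unitaryPart (1 : A) = 1 := by simp [unitaryPart]
    rwa [h1] at this
  · rintro _ ⟨c, ⟨hc, hcB⟩, rfl⟩
    refine ⟨unitaryPart_mem_unitary hc, ?_⟩
    have h1 : (c - 1) * (1 - k) = 0 := by rw [mul_sub, mul_one, hcB.2, sub_self]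
    have h2 : (star c - 1) * (1 - k) = 0 := by
      have := (star_mem hcB : star (c - 1) ∈ localUnitSubalgebra hk).2
      rw [star_sub, star_one] at this
      rw [mul_sub, mul_one, this, sub_self]
    have h3 : c * (1 - k) = 1 - k := by rwa [sub_mul, one_mul, sub_eq_zero] at h1
    have h4 : star c * (1 - k) = 1 - k := by rwa [sub_mul, one_mul, sub_eq_zero] at h2
    have := norm_unitaryPart_mul_sub_le hc (1 - k)
    rw [mul_assoc, h3, h4, sub_self, norm_zero, add_zero] at this
    rw [sub_mul, one_mul]
    exact norm_le_zero_iff.1 this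

lemma norm_le_of_le_of_neg_le {d : A} (hd : IsSelfAdjoint d) {r : ℝ} (hr : 0 ≤ r)
    (h1 : d ≤ algebraMap ℝ A r) (h2 : -d ≤ algebraMap ℝ A r) : ‖d‖ ≤ r := by
  rw [← cfc_id ℝ d]
  refine norm_cfc_le hr fun x hx => ?_
  rw [neg_le, ← map_neg] at h2
  exact abs_le.2 ⟨(algebraMap_le_iff_le_spectrum (R := ℝ)).1 h2 x hx,
    (le_algebraMap_iff_spectrum_le (R := ℝ)).1 h1 x hx⟩

lemma norm_cfcAbs_sub_cfcAbs_le {a b : A} :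
    ‖CFC.abs a - CFC.abs b‖ ≤ √‖star a * a - star b * b‖ := by
  have key (a b : A) :
      CFC.abs a - CFC.abs b ≤ algebraMap ℝ A (√‖star a * a - star b * b‖) := by
    set s := √‖star a * a - star b * b‖ with hs
    have hs0 : 0 ≤ algebraMap ℝ A s := by
      rw [← map_zero (algebraMap ℝ A)]
      exact algebraMap_mono A (Real.sqrt_nonneg _)
    have h0 := CFC.abs_nonneg b
    rw [sub_le_iff_le_add, add_comm]
    have h1 : star a * a ≤ (CFC.abs b + algebraMap ℝ A s) * (CFC.abs b + algebraMap ℝ A s) := by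
      have h2 : star a * a - star b * b ≤ algebraMap ℝ A (s * s) := by
        rw [hs, Real.mul_self_sqrt (norm_nonneg _)]
        exact IsSelfAdjoint.le_algebraMap_norm_self
          ((IsSelfAdjoint.star_mul_self a).sub (IsSelfAdjoint.star_mul_self b))
      have h3 : 0 ≤ (2 * s) • CFC.abs b :=
        smul_nonneg (by positivity) h0
      have h4 : (CFC.abs b + algebraMap ℝ A s) * (CFC.abs b + algebraMap ℝ A s) =
          star b * b + algebraMap ℝ A (s * s) + (2 * s) • CFC.abs b := by
        rw [← CFC.abs_mul_abs, mul_add, add_mul, add_mul, ← map_mul, ← Algebra.commutes,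
          ← Algebra.smul_def, two_mul, add_smul]
        abel
      rw [h4]
      refine le_trans ?_ (le_add_of_nonneg_right h3)
      rwa [add_comm, ← sub_le_iff_le_add]
    have h5 := CFC.monotone_sqrt h1
    rwa [CFC.sqrt_mul_self _ (add_nonneg h0 hs0)] at h5
  refine norm_le_of_le_of_neg_le ((CFC.abs_nonneg a).isSelfAdjoint.sub
    (CFC.abs_nonneg b).isSelfAdjoint) (Real.sqrt_nonneg _) (key a b) ?_
  rw [neg_sub, norm_sub_rev]
  exact key b a

lemma exists_spectral_cutoffs {h : A} (h0 : 0 ≤ h) {η : ℝ} (hη : 0 < η) :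
    ∃ g k m : A, IsSelfAdjoint g ∧ IsSelfAdjoint k ∧ k * g = g ∧ g * k = g ∧ ‖g‖ ≤ 1 ∧
      ‖k * h‖ ≤ 2 * η ∧ h * m = 1 - g ∧ ‖m‖ ≤ 1 / η := by
  have hsa := h0.isSelfAdjoint
  have hpos {x : ℝ} (hx : x ∈ spectrum ℝ h) : 0 ≤ x := spectrum_nonneg_of_nonneg h0 hx
  have hne (x : ℝ) : max x η ≠ 0 := (hη.trans_le (le_max_right _ _)).ne'
  have cm : Continuous fun x : ℝ => (max x η)⁻¹ := by fun_prop (disch := exact hne _)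
  have cg : Continuous fun x : ℝ => 1 - x * (max x η)⁻¹ := by fun_prop
  have ck : Continuous fun x : ℝ => max 0 (min 1 (2 - x / η)) := by fun_prop
  have hkg : cfc (fun x : ℝ => max 0 (min 1 (2 - x / η))) h *
      cfc (fun x : ℝ => 1 - x * (max x η)⁻¹) h = cfc (fun x : ℝ => 1 - x * (max x η)⁻¹) h := by
    rw [← cfc_mul _ _ h ck.continuousOn cg.continuousOn]
    refine cfc_congr fun x hx => ?_
    rcases le_total x η with hle | hle
    · have : x / η ≤ 1 := (div_le_one hη).2 hle
      simp [min_eq_left (by linarith : (1 : ℝ) ≤ 2 - x / η)]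
    · have : x ≠ 0 := (hη.trans_le hle).ne'
      simp [max_eq_left hle, this]
  refine ⟨cfc (fun x : ℝ => 1 - x * (max x η)⁻¹) h, cfc (fun x : ℝ => max 0 (min 1 (2 - x / η))) h,
    cfc (fun x : ℝ => (max x η)⁻¹) h, cfc_predicate _ _, cfc_predicate _ _, hkg,
    ?_, ?_, ?_, ?_, ?_⟩
  · exact (cfc_commute_cfc (R := ℝ) _ _ h).eq.trans hkg
  · refine norm_cfc_le zero_le_one fun x hx => abs_le.2 ?_
    have h1 : x * (max x η)⁻¹ ≤ 1 := by
      rw [← div_eq_mul_inv]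
      exact div_le_one_of_le₀ (le_max_left _ _) (hη.le.trans (le_max_right _ _))
    have h2 : 0 ≤ x * (max x η)⁻¹ :=
      mul_nonneg (hpos hx) (inv_nonneg.2 (hη.le.trans (le_max_right _ _)))
    constructor <;> linarith
  · nth_rw 2 [← cfc_id' ℝ h]
    rw [← cfc_mul _ _ h ck.continuousOn (continuousOn_id' _)]
    refine norm_cfc_le (by positivity) fun x hx => ?_
    have hx0 := hpos hx
    rw [Real.norm_of_nonneg (mul_nonneg (le_max_left _ _) hx0)]
    rcases le_total x (2 * η) with hle | hle
    · have : max 0 (min 1 (2 - x / η)) ≤ 1 := max_le zero_le_one (min_le_left _ _)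
      nlinarith
    · have : 2 ≤ x / η := (le_div_iff₀ hη).2 hle
      rw [max_eq_left ((min_le_right _ _).trans (by linarith)), zero_mul]
      positivity
  · nth_rw 1 [← cfc_id' ℝ h]
    rw [← cfc_mul _ _ h (continuousOn_id' _) cm.continuousOn,
      cfc_sub _ _ h continuousOn_const (by fun_prop), cfc_const_one ℝ h, sub_sub_cancel]
  · refine norm_cfc_le (by positivity) fun x hx => ?_
    rw [Real.norm_of_nonneg (inv_nonneg.2 (hη.le.trans (le_max_right _ _))), one_div]
    exact inv_anti₀ hη (le_max_right _ _)

lemma isUnit_of_mem_segment_of_isStrictlyPositive {h h' x : A} (hh : IsStrictlyPositive h)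
    (hh' : IsStrictlyPositive h') (hx : x ∈ segment ℝ h h') : IsUnit x := by
  obtain ⟨s, t, hs, ht, hst, rfl⟩ := hx
  rcases hs.eq_or_lt with rfl | hs
  · obtain rfl : t = 1 := by linarith
    simpa using hh'.isUnit
  · exact ((hh.smul hs).add_nonneg (smul_nonneg ht hh'.nonneg)).isUnit

lemma norm_unitaryPart_sub_le {w w' : A} (hw : w ∈ unitary A) (hw' : IsUnit w') :
    ‖unitaryPart w' - w‖ ≤ ‖w - w'‖ * (‖w - w'‖ + 3) := by
  have hW := unitaryPart_mem_unitary hw'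
  have hn (x : A) : ‖star w * x‖ = ‖x‖ := CStarRing.norm_coe_unitary_mul ⟨_, Unitary.star_mem hw⟩ x
  have h1 : ‖unitaryPart w' - w'‖ ≤ ‖CFC.abs w' - 1‖ := by
    have h2 : unitaryPart w' - w' = unitaryPart w' * (1 - CFC.abs w') := by
      rw [mul_sub, mul_one, unitaryPart_mul_abs hw']
    rw [h2, CStarRing.norm_coe_unitary_mul ⟨_, hW⟩, norm_sub_rev]
  have h3 : ‖CFC.abs w' - 1‖ ≤ ‖w - w'‖ * (‖w - w'‖ + 2) := by
    have h4 := norm_sub_one_mul_le (CFC.abs_nonneg w') 1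
    rw [mul_one, mul_one, CFC.abs_mul_abs] at h4
    have h5 : star w' * w' - 1 = star (w' - w) * (w' - w) + (star w * (w' - w) +
        star (star w * (w' - w))) := by
      rw [star_mul, star_star, star_sub, mul_sub, mul_sub, sub_mul, sub_mul, hw.1]
      abel
    rw [h5] at h4
    refine h4.trans ((norm_add_le _ _).trans ?_)
    have h6 := norm_add_le (star w * (w' - w)) (star (star w * (w' - w)))
    rw [norm_star, hn] at h6
    rw [CStarRing.norm_star_mul_self]
    rw [norm_sub_rev w' w] at h6 ⊢
    linarith
  have h7 := norm_sub_le_norm_sub_add_norm_sub (unitaryPart w') w' w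
  rw [norm_sub_rev w' w] at h7
  linarith

lemma NoK1Obstructions.joinedIn_of_norm_cfcAbs_sub_le (hA : NoK1Obstructions A) {a b : A}
    (ha : IsUnit a) (hb : IsUnit b) {ε η ρ σ : ℝ} (hη : 0 < η) (hηε : 8 * η ≤ ε)
    (hρ : 16 * ρ ≤ 1) (hρε : 16 * ρ ≤ ε) (hσ : 0 < σ) (hση : 2 * σ ≤ ρ * η) (hσε : 4 * σ ≤ ε)
    (h1 : ‖a - b‖ ≤ σ) (h2 : ‖CFC.abs a - CFC.abs b‖ ≤ σ) :
    JoinedIn {c : A | IsUnit c ∧ ‖c - a‖ < ε} a b := by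
  have hρ0 : 0 < ρ := pos_of_mul_pos_left (by linarith : 0 < ρ * η) hη.le
  obtain ⟨g, k, m, hg, hk, hkg, hgk, hg1, hkh, hm, hm1⟩ :=
    exists_spectral_cutoffs (CFC.abs_nonneg a) hη
  have hua := unitaryPart_mul_abs ha
  have hvb := unitaryPart_mul_abs hb
  have hU := unitaryPart_mem_unitary ha
  have hV := unitaryPart_mem_unitary hb
  have hpa := isStrictlyPositive_cfcAbs ha
  have hpb := isStrictlyPositive_cfcAbs hb
  generalize unitaryPart a = u at *
  generalize unitaryPart b = v at *
  generalize CFC.abs a = h at *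
  generalize CFC.abs b = h' at *
  have nu (x : A) : ‖u * x‖ = ‖x‖ := CStarRing.norm_coe_unitary_mul ⟨_, hU⟩ x
  have nv (x : A) : ‖v * x‖ = ‖x‖ := CStarRing.norm_coe_unitary_mul ⟨_, hV⟩ x
  have hw : star u * v ∈ unitary A := mul_mem (Unitary.star_mem hU) hV
  have huw : u * (star u * v) = v := by rw [← mul_assoc, hU.2, one_mul]
  generalize star u * v = w at *
  have hvh : ‖v * h - a‖ ≤ 2 * σ := by
    have : v * h - a = v * (h - h') - (a - b) := by rw [mul_sub, hvb]; abel
    rw [this]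
    refine (norm_sub_le _ _).trans ?_
    rw [nv]; linarith
  have hwh : ‖(w - 1) * h‖ ≤ 2 * σ := by
    rw [← nu, ← mul_assoc, mul_sub, huw, mul_one, sub_mul, hua]
    exact hvh
  have hwg : ‖(w - 1) * (1 - g)‖ ≤ ρ := by
    rw [← hm, ← mul_assoc]
    refine (norm_mul_le _ _).trans ((mul_le_mul hwh hm1 (norm_nonneg _) (by positivity)).trans ?_)
    rw [mul_one_div, div_le_iff₀ hη]
    exact hση
  have hww := norm_sub_compress_le hg1
    ((norm_star_sub_one_mul hw ((IsSelfAdjoint.one A).sub hg)).le.trans hwg) hwg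
  set w' := 1 + g * (w - 1) * g with hw'
  have hw'1 : w' - 1 = g * (w - 1) * g := by rw [hw', add_sub_cancel_left]
  have hu' : IsUnit w' := isUnit_of_norm_unitary_sub_lt hw (by linarith)
  have hj := hA.joinedIn_unitary hk hu' (by rw [hw'1, ← mul_assoc, ← mul_assoc, hkg])
    (by rw [hw'1, mul_assoc, hgk])
  have hWw : ‖unitaryPart w' - w‖ ≤ 8 * ρ := by
    refine (norm_unitaryPart_sub_le hw hu').trans ?_
    nlinarith [norm_nonneg (w - w')]
  have hW := unitaryPart_mem_unitary hu'
  generalize unitaryPart w' = W at *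
  have hclose {z : A} (hz : z ∈ unitary A) (hz1 : (z - 1) * (1 - k) = 0) :
      ‖u * z * h - a‖ ≤ 4 * η := by
    have e1 : u * z * h - a = u * ((z - 1) * h) := by
      rw [sub_mul, one_mul, mul_sub, hua, mul_assoc]
    have e2 : (z - 1) * h = z * (k * h) - k * h := by
      have : (z - 1) * h = (z - 1) * (1 - k) * h + (z - 1) * k * h := by noncomm_ring
      rw [this, hz1]; noncomm_ring
    rw [e1, nu, e2]
    refine (norm_sub_le _ _).trans ?_
    rw [CStarRing.norm_coe_unitary_mul ⟨_, hz⟩]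
    linarith
  have isUnit_of_unitary {z : A} (hz : z ∈ unitary A) : IsUnit z :=
    ⟨⟨z, star z, hz.2, hz.1⟩, rfl⟩
  have hIu := isUnit_of_unitary hU
  have hIv := isUnit_of_unitary hV
  have j1 : JoinedIn {c : A | IsUnit c ∧ ‖c - a‖ < ε} (u * 1 * h) (u * W * h) := by
    refine (JoinedIn.map hj (f := fun z => u * z * h) (by fun_prop)).mono ?_
    rintro _ ⟨z, ⟨hz, hz1⟩, rfl⟩
    exact ⟨(hIu.mul (isUnit_of_unitary hz)).mul hpa.isUnit,
      (hclose hz hz1).trans_lt (by linarith)⟩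
  have j2 := joinedIn_of_segment hIu hpa.isUnit (x := W) (y := w)
    (fun z hz => isUnit_of_mem_segment_of_unitary hW (by linarith) hz) j1.target_mem.2
    (by rw [huw]; linarith)
  have j3 := joinedIn_of_segment (l := v) (r := 1) (a := a) (ε := ε) hIv isUnit_one
    (fun z hz => isUnit_of_mem_segment_of_isStrictlyPositive hpa hpb hz)
    (by rw [mul_one]; linarith)
    (by rw [mul_one, hvb, norm_sub_rev]; linarith)
  rw [mul_one, hua] at j1
  rw [huw] at j2
  rw [mul_one, mul_one, hvb] at j3
  exact (j1.trans j2).trans j3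

end Paths

theorem stmt1 (A : Type*) [CStarAlgebra A] (hA : NoK1Obstructions A) :
    ∀ ε : ℝ, 0 < ε → ∃ δ : ℝ, 0 < δ ∧
      ∀ a b : A, IsUnit a → IsUnit b → ‖a‖ ≤ 1 → ‖b‖ ≤ 1 → ‖a - b‖ < δ →
        ∃ c : C(unitInterval, A), c 0 = a ∧ c 1 = b ∧
          (∀ t : unitInterval, IsUnit (c t)) ∧ ∀ t : unitInterval, ‖c t - a‖ < ε := by
  intro ε hε
  let _ := CStarAlgebra.spectralOrder A
  have := CStarAlgebra.spectralOrderedRing A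
  set ρ := min (1 / 16) (ε / 16) with hρ
  have hρ0 : 0 < ρ := by positivity
  set σ := min (ρ * (ε / 8) / 2) (ε / 4) with hσ
  have hσ0 : 0 < σ := by positivity
  refine ⟨min σ (σ ^ 2 / 2), by positivity, fun a b ha hb ha1 hb1 hab => ?_⟩
  rw [lt_min_iff] at hab
  have h2 : ‖CFC.abs a - CFC.abs b‖ ≤ σ := by
    refine norm_cfcAbs_sub_cfcAbs_le.trans (Real.sqrt_le_iff.2 ⟨hσ0.le, ?_⟩)
    have : star a * a - star b * b = star a * (a - b) + star (a - b) * b := by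
      rw [star_sub, mul_sub, sub_mul]; abel
    rw [this]
    have h3 : ‖star a * (a - b)‖ ≤ ‖a - b‖ := (norm_mul_le _ _).trans
      (mul_le_of_le_one_left (norm_nonneg _) (by rwa [norm_star]))
    have h4 : ‖star (a - b) * b‖ ≤ ‖a - b‖ := (norm_mul_le _ _).trans
      (by rw [norm_star]; exact mul_le_of_le_one_right (norm_nonneg _) hb1)
    linarith [norm_add_le (star a * (a - b)) (star (a - b) * b)]
  have m1 : ρ ≤ 1 / 16 := min_le_left _ _
  have m2 : ρ ≤ ε / 16 := min_le_right _ _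
  have m3 : σ ≤ ρ * (ε / 8) / 2 := min_le_left _ _
  have m4 : σ ≤ ε / 4 := min_le_right _ _
  obtain ⟨γ, hγ⟩ := hA.joinedIn_of_norm_cfcAbs_sub_le ha hb (ε := ε) (η := ε / 8) (ρ := ρ)
    (σ := σ) (by positivity) (by linarith) (by linarith) (by linarith) hσ0 (by linarith)
    (by linarith) hab.1.le h2
  exact ⟨γ.toContinuousMap, γ.source, γ.target, fun t => (hγ t).1, fun t => (hγ t).2⟩
end
end
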